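/- arXiv:1009.2591 — 3 statements merged into one kernel-verified Lean document; each statement's English description precedes it below -/
import Mathlib

section
/- For the monotone 1-in-3 SAT reduction, there exists a multiset B of items of total cost exactly 14m such that (A ∪ B, E) admits a popular matching matching all people if and only if the SAT instance admits a truth assignment setting exactly one literal true in every clause. -/
/-- Person `a` prefers matching `M` to `M'`. -/
def Prefers {α β : Type*} (rank : α → β → ℕ∞) (M M' : α → Option β) (a : α) : Prop :=
  (∃ b, M a = some b ∧ M' a = none) ∨
  (∃ b b', M a = some b ∧ M' a = some b' ∧ rank a b < rank a b')

/-- `M'` is more popular than `M`. -/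
def MorePopular {α β : Type*} [Fintype α] (rank : α → β → ℕ∞) (M' M : α → Option β) : Prop :=
  Nat.card {a // Prefers rank M M' a} < Nat.card {a // Prefers rank M' M a}

/-- `(a,b)` is an edge of the instance: `b` is on `a`'s preference list. -/
def Edge {α β : Type*} (rank : α → β → ℕ∞) (a : α) (b : β) : Prop := rank a b ≠ ⊤

/-- Number of people matched to item `b`. -/
noncomputable def usage {α β : Type*} [Fintype α] (M : α → Option β) (b : β) : ℕ :=
  Nat.card {a // M a = some b}

/-- A matching of the instance in which each item `b` may be matched to up to
`copies b` people (`copies b = 0` means `b` is not available). -/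
def IsCapMatching {α β : Type*} [Fintype α] (rank : α → β → ℕ∞) (copies : β → ℕ)
    (M : α → Option β) : Prop :=
  (∀ a b, M a = some b → Edge rank a b) ∧ ∀ b, usage M b ≤ copies b

/-- A popular matching of the capacitated instance. -/
def PopularCap {α β : Type*} [Fintype α] (rank : α → β → ℕ∞) (copies : β → ℕ)
    (M : α → Option β) : Prop :=
  IsCapMatching rank copies M ∧
  ∀ M', IsCapMatching rank copies M' → ¬ MorePopular rank M' M

/-- A 1-in-3 satisfying assignment: exactly one literal of every clause is true. -/
def ExactlyOneTrue {n : ℕ} {m : ℕ} (cl : Fin m → Fin 3 → Fin n) (τ : Fin n → Bool) : Prop :=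
  ∀ i, ∃! k : Fin 3, τ (cl i k) = true

/-- Items of the min-cost popular instance construction: `Sum.inl j` is the public item
`u_j`; `Sum.inr (i, t)` with `t = 0,1,2` are the internal items `p₁,p₂,p₃` of clause `i`
and `t = 3` is the internal item `q` of clause `i`. -/
abbrev InstItems (m n : ℕ) := Fin n ⊕ (Fin m × Fin 4)

/-- Preference lists of the 9 people of each clause gadget (Fig. 1):
for clause `Cᵢ = (X_{j₁} ∨ X_{j₂} ∨ X_{j₃})`, person `a₁..a₃` have lists
`(u_{j₁},u_{j₂})`, `(u_{j₂},u_{j₃})`, `(u_{j₁},u_{j₃})`; `a₄..a₆` have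
`(u_{j₁},p₁)`, `(u_{j₂},p₂)`, `(u_{j₃},p₃)`; `a₇..a₉` have `(p₁,q)`, `(p₂,q)`, `(p₃,q)`. -/
def instRank {m n : ℕ} (cl : Fin m → Fin 3 → Fin n) :
    Fin m × Fin 9 → InstItems m n → ℕ∞ := fun a b =>
  let i := a.1
  let k : ℕ := (a.2 : ℕ)
  match b with
  | Sum.inl u =>
      if k = 0 then (if u = cl i 0 then 1 else if u = cl i 1 then 2 else ⊤)
      else if k = 1 then (if u = cl i 1 then 1 else if u = cl i 2 then 2 else ⊤)
      else if k = 2 then (if u = cl i 0 then 1 else if u = cl i 2 then 2 else ⊤)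
      else if k = 3 then (if u = cl i 0 then 1 else ⊤)
      else if k = 4 then (if u = cl i 1 then 1 else ⊤)
      else if k = 5 then (if u = cl i 2 then 1 else ⊤)
      else ⊤
  | Sum.inr jt =>
      if jt.1 = i then
        (if k = 3 ∧ (jt.2 : ℕ) = 0 then 2
         else if k = 4 ∧ (jt.2 : ℕ) = 1 then 2
         else if k = 5 ∧ (jt.2 : ℕ) = 2 then 2
         else if k = 6 ∧ (jt.2 : ℕ) = 0 then 1
         else if k = 7 ∧ (jt.2 : ℕ) = 1 then 1
         else if k = 8 ∧ (jt.2 : ℕ) = 2 then 1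
         else if k = 6 ∧ (jt.2 : ℕ) = 3 then 2
         else if k = 7 ∧ (jt.2 : ℕ) = 3 then 2
         else if k = 8 ∧ (jt.2 : ℕ) = 3 then 2
         else ⊤)
      else ⊤

/-- Costs: each public item `u_j` costs 3, each internal item `p_t` costs 1, and each
internal item `q` costs 0. -/
def instCost {m n : ℕ} : InstItems m n → ℕ := fun b =>
  match b with
  | Sum.inl _ => 3
  | Sum.inr jt => if (jt.2 : ℕ) = 3 then 0 else 1

/-- Total cost of buying the chosen numbers of copies of the items. -/
def instTotalCost {m n : ℕ} (copies : InstItems m n → ℕ) : ℕ :=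
  ∑ b : InstItems m n, copies b * instCost b

/-- Cost accounting for a matching that matches everybody. -/
lemma sum_usage_mul {α β : Type*} [Fintype α] [Fintype β] (N : α → β) (c : β → ℕ) :
    ∑ b, usage (fun a => some (N a)) b * c b = ∑ a, c (N a) := by
  classical
  rw [← Finset.sum_fiberwise Finset.univ N (fun a => c (N a))]
  refine Finset.sum_congr rfl fun b _ => ?_
  rw [Finset.sum_congr rfl (g := fun _ => c b)
    (fun a ha => by rw [(Finset.mem_filter.1 ha).2])]
  simp [usage, Nat.card_eq_fintype_card, Fintype.card_subtype]

/-- A sufficient criterion for popularity. -/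
lemma popular_of_good {α β : Type*} [Fintype α] [Fintype β] (rank : α → β → ℕ∞) (N : α → β)
    (G Av : β → Prop) (hE : ∀ a, Edge rank a (N a)) (hAv : ∀ a, Av (N a))
    (hG : ∀ a b', G (N a) → Av b' → b' ≠ N a → Edge rank a b' → rank a (N a) < rank a b')
    (hI : ∀ a b', Av b' → rank a b' < rank a (N a) → G b') :
    PopularCap rank (usage (fun a => some (N a))) (fun a => some (N a)) := by
  classical
  refine ⟨⟨fun a b h => ?_, fun b => le_rfl⟩, ?_⟩
  · cases h; exact hE a
  rintro M' ⟨hE', hU⟩ hlt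
  have hav' : ∀ a b, M' a = some b → Av b := by
    intro a b h
    have h1 : 0 < usage M' b := by
      unfold usage
      have : Nonempty {a // M' a = some b} := ⟨⟨a, h⟩⟩
      exact Nat.card_pos
    have h2 := lt_of_lt_of_le h1 (hU b)
    unfold usage at h2
    obtain ⟨⟨⟨x, hx⟩⟩, _⟩ := Nat.card_pos_iff.1 h2
    cases hx
    exact hAv x
  let X : Finset α := Finset.univ.filter fun a => G (N a)
  let X' : Finset α := Finset.univ.filter fun a => ∃ b, M' a = some b ∧ G b
  have key : ∀ M : α → Option β,
      (Finset.univ.filter fun a => ∃ b, M a = some b ∧ G b).card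
        = ∑ b ∈ Finset.univ.filter G, usage M b := by
    intro M
    have : (Finset.univ.filter fun a => ∃ b, M a = some b ∧ G b)
        = (Finset.univ.filter G).biUnion fun b => Finset.univ.filter fun a => M a = some b := by
      ext a
      simp only [Finset.mem_filter, Finset.mem_univ, true_and, Finset.mem_biUnion]
      exact exists_congr fun b => and_comm
    rw [this, Finset.card_biUnion]
    · refine Finset.sum_congr rfl fun b _ => ?_
      simp [usage, Nat.card_eq_fintype_card, Fintype.card_subtype]
    · intro b _ b' _ hne
      refine Finset.disjoint_left.2 fun a h h' => hne ?_
      have h1 := (Finset.mem_filter.1 h).2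
      have h2 := (Finset.mem_filter.1 h').2
      rw [h1] at h2
      exact Option.some.inj h2
  have hXX : X'.card ≤ X.card := by
    have hX : X = Finset.univ.filter fun a => ∃ b, (fun a => some (N a)) a = some b ∧ G b := by
      ext a; simp [X]
    rw [hX, key M', key (fun a => some (N a))]
    exact Finset.sum_le_sum fun b _ => hU b
  have hd : (X' \ X).card ≤ (X \ X').card := by
    have h1 := Finset.card_sdiff_add_card_inter X' X
    have h2 := Finset.card_sdiff_add_card_inter X X'
    rw [Finset.inter_comm] at h2
    omega
  unfold MorePopular at hlt
  rw [Nat.card_eq_fintype_card, Nat.card_eq_fintype_card, Fintype.card_subtype,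
    Fintype.card_subtype] at hlt
  have i1 : (Finset.univ.filter fun a => Prefers rank M' (fun a => some (N a)) a) ⊆ X' \ X := by
    intro a ha
    rcases (Finset.mem_filter.1 ha).2 with ⟨b, _, h⟩ | ⟨b, b', h, h', hr⟩
    · cases h
    · cases h'
      have hb := hav' a b h
      refine Finset.mem_sdiff.2 ⟨?_, fun hx => ?_⟩
      · simp only [X', Finset.mem_filter, Finset.mem_univ, true_and]
        exact ⟨b, h, hI a b hb hr⟩
      · have hg := (Finset.mem_filter.1 hx).2
        have := hG a b hg hb (by rintro rfl; exact lt_irrefl _ hr) (hE' a b h)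
        exact lt_asymm this hr
  have i2 : X \ X' ⊆ (Finset.univ.filter fun a => Prefers rank (fun a => some (N a)) M' a) := by
    intro a ha
    obtain ⟨h1, h2⟩ := Finset.mem_sdiff.1 ha
    have hg := (Finset.mem_filter.1 h1).2
    simp only [X', Finset.mem_filter, Finset.mem_univ, true_and, not_exists, not_and] at h2
    refine Finset.mem_filter.2 ⟨Finset.mem_univ _, ?_⟩
    cases hM : M' a with
    | none => exact Or.inl ⟨_, rfl, hM⟩
    | some b =>
      refine Or.inr ⟨_, b, rfl, hM, hG a b hg (hav' a b hM) ?_ (hE' a b hM)⟩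
      rintro rfl
      exact h2 _ hM hg
  have := Finset.card_le_card i1
  have := Finset.card_le_card i2
  omega

/-- A popular matching leaves no improving chain `c → p`, `a → u`. -/
lemma no_chain {α β : Type*} [Fintype α] (rank : α → β → ℕ∞) (copies : β → ℕ)
    (M : α → Option β) (hM : PopularCap rank copies M) {a c : α} {u p q : β} (hac : a ≠ c)
    (hup : u ≠ p) (huq : u ≠ q) (ha : M a = some p) (hc : M c = some q)
    (hu : 0 < copies u) (h1 : rank a u < rank a p) (h2 : rank c p < rank c q) : False := by
  classical
  obtain ⟨⟨hE, hU⟩, hP⟩ := hM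
  have ucard : ∀ (K : α → Option β) b, usage K b = (Finset.univ.filter fun y => K y = some b).card :=
    fun K b => by simp [usage, Nat.card_eq_fintype_card, Fintype.card_subtype]
  obtain ⟨S, hS, hS1, hSu⟩ : ∃ S : Finset α, (∀ y ∈ S, M y = some u) ∧ S.card ≤ 1 ∧
      ((Finset.univ.filter fun y => M y = some u) \ S).card + 1 ≤ copies u := by
    by_cases h : usage M u < copies u
    · refine ⟨∅, by simp, by simp, ?_⟩
      rw [ucard] at h
      simpa using h
    · have hpos : 0 < (Finset.univ.filter fun y => M y = some u).card := by
        rw [← ucard]; omega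
      obtain ⟨x, hx⟩ := Finset.card_pos.1 hpos
      refine ⟨{x}, ?_, by simp, ?_⟩
      · intro y hy
        rw [Finset.mem_singleton.1 hy]
        exact (Finset.mem_filter.1 hx).2
      · rw [Finset.card_sdiff_of_subset (by simpa using hx)]
        have := hU u
        rw [ucard] at this
        simp only [Finset.card_singleton]
        omega
  have haS : a ∉ S := fun h => by
    have := hS a h; rw [ha] at this; exact hup (Option.some.inj this).symm
  have hcS : c ∉ S := fun h => by
    have := hS c h; rw [hc] at this; exact huq (Option.some.inj this).symm
  let M' : α → Option β := fun y =>
    if y = a then some u else if y = c then some p else if y ∈ S then none else M y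
  have hMa : M' a = some u := by simp [M']
  have hMc : M' c = some p := by simp [M', hac.symm]
  have hMS : ∀ y, y ≠ a → y ≠ c → y ∈ S → M' y = none := by
    intro y h1 h2 h3; simp [M', h1, h2, h3]
  have hMo : ∀ y, y ≠ a → y ≠ c → y ∉ S → M' y = M y := by
    intro y h1 h2 h3; simp [M', h1, h2, h3]
  have hsome : ∀ y b, y ≠ a → y ≠ c → M' y = some b → M y = some b ∧ y ∉ S := by
    intro y b h1 h2 h3
    by_cases hy : y ∈ S
    · rw [hMS y h1 h2 hy] at h3; cases h3
    · rw [hMo y h1 h2 hy] at h3; exact ⟨h3, hy⟩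
  refine hP M' ⟨?_, ?_⟩ ?_
  · intro y b h
    by_cases hya : y = a
    · subst hya; rw [hMa] at h; cases h; exact ne_top_of_lt h1
    by_cases hyc : y = c
    · subst hyc; rw [hMc] at h; cases h; exact ne_top_of_lt h2
    exact hE y b (hsome y b hya hyc h).1
  · intro b
    rw [ucard]
    by_cases hbu : b = u
    · subst hbu
      refine le_trans (Finset.card_le_card (t :=
        insert a ((Finset.univ.filter fun y => M y = some b) \ S)) ?_)
        (le_trans (Finset.card_insert_le _ _) hSu)
      intro y hy
      have hy := (Finset.mem_filter.1 hy).2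
      by_cases hya : y = a
      · simp [hya]
      by_cases hyc : y = c
      · subst hyc; rw [hMc] at hy; exact absurd (Option.some.inj hy).symm hup
      obtain ⟨h3, h4⟩ := hsome y b hya hyc hy
      simp [h3, h4]
    · by_cases hbp : b = p
      · subst hbp
        refine le_trans (Finset.card_le_card (t :=
          insert c ((Finset.univ.filter fun y => M y = some b).erase a)) ?_)
          (le_trans (Finset.card_insert_le _ _) ?_)
        · intro y hy
          have hy := (Finset.mem_filter.1 hy).2
          by_cases hya : y = a
          · subst hya; rw [hMa] at hy; exact absurd (Option.some.inj hy) hup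
          by_cases hyc : y = c
          · simp [hyc]
          obtain ⟨h3, h4⟩ := hsome y b hya hyc hy
          simp [h3, hya]
        · rw [Finset.card_erase_add_one (by simp [ha]), ← ucard]
          exact hU b
      · refine le_trans (Finset.card_le_card ?_) ((ucard M b).symm.le.trans (hU b))
        intro y hy
        have hy := (Finset.mem_filter.1 hy).2
        by_cases hya : y = a
        · subst hya; rw [hMa] at hy; exact absurd (Option.some.inj hy).symm hbu
        by_cases hyc : y = c
        · subst hyc; rw [hMc] at hy; exact absurd (Option.some.inj hy).symm hbp
        simp [(hsome y b hya hyc hy).1]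
  · unfold MorePopular
    rw [Nat.card_eq_fintype_card, Nat.card_eq_fintype_card, Fintype.card_subtype,
      Fintype.card_subtype]
    have w : (Finset.univ.filter fun y => Prefers rank M M' y) ⊆ S := by
      intro y hy
      have hy := (Finset.mem_filter.1 hy).2
      by_contra hyS
      by_cases hya : y = a
      · subst hya
        rcases hy with ⟨b, _, h⟩ | ⟨b, b', h, h', hr⟩
        · rw [hMa] at h; cases h
        · rw [hMa] at h'; rw [ha] at h; cases h; cases h'; exact lt_asymm h1 hr
      by_cases hyc : y = c
      · subst hyc
        rcases hy with ⟨b, _, h⟩ | ⟨b, b', h, h', hr⟩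
        · rw [hMc] at h; cases h
        · rw [hMc] at h'; rw [hc] at h; cases h; cases h'; exact lt_asymm h2 hr
      have := hMo y hya hyc hyS
      rcases hy with ⟨b, h, h'⟩ | ⟨b, b', h, h', hr⟩
      · rw [this, h] at h'; cases h'
      · rw [this, h] at h'; cases h'; exact lt_irrefl _ hr
    have g : ({a, c} : Finset α) ⊆ (Finset.univ.filter fun y => Prefers rank M' M y) := by
      intro y hy
      refine Finset.mem_filter.2 ⟨Finset.mem_univ _, ?_⟩
      rcases Finset.mem_insert.1 hy with rfl | hy
      · exact Or.inr ⟨_, _, hMa, ha, h1⟩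
      · rw [Finset.mem_singleton.1 hy]
        exact Or.inr ⟨_, _, hMc, hc, h2⟩
    have := Finset.card_le_card w
    have := Finset.card_le_card g
    rw [Finset.card_pair hac] at this
    omega

/-- The person `a_{4+t}`. -/
def midP (t : Fin 3) : Fin 9 := ⟨t.1 + 3, by omega⟩
/-- The person `a_{7+t}`. -/
def lowP (t : Fin 3) : Fin 9 := ⟨t.1 + 6, by omega⟩
/-- The item `p_{1+t}`. -/
def pIt (t : Fin 3) : Fin 4 := ⟨t.1, by omega⟩

section ranks
variable {m n : ℕ} (cl : Fin m → Fin 3 → Fin n)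

lemma edge_top (i : Fin m) (k : Fin 9) (hk : k.1 < 3) (b : InstItems m n)
    (h : Edge (instRank cl) (i, k) b) : ∃ u, b = Sum.inl u := by
  rcases b with u | jt
  · exact ⟨u, rfl⟩
  · exfalso
    apply h
    have h3 : k.1 ≠ 3 := by omega
    have h4 : k.1 ≠ 4 := by omega
    have h5 : k.1 ≠ 5 := by omega
    have h6 : k.1 ≠ 6 := by omega
    have h7 : k.1 ≠ 7 := by omega
    have h8 : k.1 ≠ 8 := by omega
    simp [instRank, h3, h4, h5, h6, h7, h8]

lemma rank_mid_inl (i : Fin m) (t : Fin 3) (u : Fin n) :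
    instRank cl (i, midP t) (Sum.inl u) = if u = cl i t then 1 else ⊤ := by
  fin_cases t <;> simp [instRank, midP]

lemma rank_mid_inr (i : Fin m) (t : Fin 3) (j : Fin m) (s : Fin 4) :
    instRank cl (i, midP t) (Sum.inr (j, s)) = if j = i ∧ s = pIt t then 2 else ⊤ := by
  by_cases h : j = i <;> fin_cases t <;> fin_cases s <;> simp [instRank, midP, pIt, h]

lemma rank_low_inl (i : Fin m) (t : Fin 3) (u : Fin n) :
    instRank cl (i, lowP t) (Sum.inl u) = ⊤ := by
  fin_cases t <;> simp [instRank, lowP]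

lemma rank_low_inr (i : Fin m) (t : Fin 3) (j : Fin m) (s : Fin 4) :
    instRank cl (i, lowP t) (Sum.inr (j, s)) =
      if j = i then (if s = pIt t then 1 else if s = 3 then 2 else ⊤) else ⊤ := by
  by_cases h : j = i <;> fin_cases t <;> fin_cases s <;> simp [instRank, lowP, pIt, h]

lemma rank_zero (i : Fin m) (u : Fin n) : instRank cl (i, 0) (Sum.inl u) =
    if u = cl i 0 then 1 else if u = cl i 1 then 2 else ⊤ := by simp [instRank]
lemma rank_one (i : Fin m) (u : Fin n) : instRank cl (i, 1) (Sum.inl u) =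
    if u = cl i 1 then 1 else if u = cl i 2 then 2 else ⊤ := by simp [instRank]
lemma rank_two (i : Fin m) (u : Fin n) : instRank cl (i, 2) (Sum.inl u) =
    if u = cl i 0 then 1 else if u = cl i 2 then 2 else ⊤ := by simp [instRank]
end ranks

lemma person_cases (k : Fin 9) :
    k = 0 ∨ k = 1 ∨ k = 2 ∨ (∃ t, k = midP t) ∨ (∃ t, k = lowP t) := by
  revert k; decide

lemma sum_people (f : Fin 9 → ℕ) :
    ∑ k, f k = f 0 + f 1 + f 2 + ∑ t, (f (midP t) + f (lowP t)) := by
  simp only [Fin.sum_univ_succ, Fin.sum_univ_three, midP, lowP]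
  simp
  change f 0 + (f 1 + (f 2 + (f 3 + (f 4 + (f 5 + (f 6 + (f 7 + f 8))))))) =
    f 0 + f 1 + f 2 + (f 3 + f 6 + (f 4 + f 7 + (f 5 + f 8)))
  ring

/-- The matching built from a 1-in-3 assignment. -/
def asgMatch {m n : ℕ} (cl : Fin m → Fin 3 → Fin n) (τ : Fin n → Bool) :
    Fin m × Fin 9 → InstItems m n := fun a =>
  if a.2 = 0 then Sum.inl (if τ (cl a.1 0) then cl a.1 1 else cl a.1 0)
  else if a.2 = 1 then Sum.inl (if τ (cl a.1 1) then cl a.1 2 else cl a.1 1)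
  else if a.2 = 2 then Sum.inl (if τ (cl a.1 0) then cl a.1 2 else cl a.1 0)
  else if a.2 = midP 0 then Sum.inr (a.1, 0)
  else if a.2 = midP 1 then Sum.inr (a.1, 1)
  else if a.2 = midP 2 then Sum.inr (a.1, 2)
  else if a.2 = lowP 0 then Sum.inr (a.1, if τ (cl a.1 0) then 3 else 0)
  else if a.2 = lowP 1 then Sum.inr (a.1, if τ (cl a.1 1) then 3 else 1)
  else Sum.inr (a.1, if τ (cl a.1 2) then 3 else 2)

section asg
variable {m n : ℕ} (cl : Fin m → Fin 3 → Fin n) (τ : Fin n → Bool) (i : Fin m)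
lemma asg_zero : asgMatch cl τ (i, 0) = Sum.inl (if τ (cl i 0) then cl i 1 else cl i 0) := by
  simp [asgMatch]
lemma asg_one : asgMatch cl τ (i, 1) = Sum.inl (if τ (cl i 1) then cl i 2 else cl i 1) := by
  simp [asgMatch]
lemma asg_two : asgMatch cl τ (i, 2) = Sum.inl (if τ (cl i 0) then cl i 2 else cl i 0) := by
  simp [asgMatch]
lemma asg_mid (t : Fin 3) : asgMatch cl τ (i, midP t) = Sum.inr (i, pIt t) := by
  fin_cases t <;> rfl
lemma asg_low (t : Fin 3) : asgMatch cl τ (i, lowP t) =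
    Sum.inr (i, if τ (cl i t) then 3 else pIt t) := by
  fin_cases t <;> rfl
end asg

lemma pIt_ne (t : Fin 3) : pIt t ≠ 3 := by revert t; decide
lemma pIt_inj : ∀ t s : Fin 3, pIt t = pIt s → t = s := by decide

lemma cost_inl {m n : ℕ} (u : Fin n) : instCost (m := m) (Sum.inl u) = 3 := rfl
lemma cost_p {m n : ℕ} (i : Fin m) (t : Fin 3) :
    instCost (n := n) (Sum.inr (i, pIt t)) = 1 := by
  fin_cases t <;> rfl
lemma cost_q {m n : ℕ} (i : Fin m) : instCost (n := n) (Sum.inr (i, 3)) = 0 := rfl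

lemma backward {m n : ℕ} (cl : Fin m → Fin 3 → Fin n) (hdist : ∀ i, Function.Injective (cl i))
    (τ : Fin n → Bool) (hτ : ExactlyOneTrue cl τ) :
    PopularCap (instRank cl) (usage fun a => some (asgMatch cl τ a))
      (fun a => some (asgMatch cl τ a)) ∧
    instTotalCost (usage fun a => some (asgMatch cl τ a)) = 14 * m := by
  have h01 : ∀ i, cl i 0 ≠ cl i 1 := fun i h => by simpa using hdist i h
  have h02 : ∀ i, cl i 0 ≠ cl i 2 := fun i h => by simpa using hdist i h
  have h12 : ∀ i, cl i 1 ≠ cl i 2 := fun i h => by simpa using hdist i h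
  have hcase : ∀ i, (τ (cl i 0) = true ∧ τ (cl i 1) = false ∧ τ (cl i 2) = false) ∨
      (τ (cl i 0) = false ∧ τ (cl i 1) = true ∧ τ (cl i 2) = false) ∨
      (τ (cl i 0) = false ∧ τ (cl i 1) = false ∧ τ (cl i 2) = true) := by
    intro i
    obtain ⟨k, hk, hu⟩ := hτ i
    have e : ∀ j : Fin 3, j ≠ k → τ (cl i j) = false := fun j hj =>
      Bool.eq_false_iff.2 fun h => hj (hu j h)
    have hk' : k = 0 ∨ k = 1 ∨ k = 2 := by
      clear hu hk e
      revert k; decide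
    rcases hk' with rfl | rfl | rfl
    · exact Or.inl ⟨hk, e 1 (by decide), e 2 (by decide)⟩
    · exact Or.inr (Or.inl ⟨e 0 (by decide), hk, e 2 (by decide)⟩)
    · exact Or.inr (Or.inr ⟨e 0 (by decide), e 1 (by decide), hk⟩)
  constructor
  · refine popular_of_good _ _
      (fun b => match b with
        | Sum.inl _ => True
        | Sum.inr (i, s) => ∃ t, s = pIt t ∧ τ (cl i t) = true)
      (fun b => match b with
        | Sum.inl u => τ u = false
        | Sum.inr _ => True) ?_ ?_ ?_ ?_
    · rintro ⟨i, k⟩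
      have a1 := h01 i
      have a2 := h02 i
      have a3 := h12 i
      unfold Edge
      rcases person_cases k with rfl | rfl | rfl | ⟨t, rfl⟩ | ⟨t, rfl⟩
      · rw [asg_zero, rank_zero]; cases τ (cl i 0) <;> simp [a1.symm, a2.symm, a3.symm]
      · rw [asg_one, rank_one]; cases τ (cl i 1) <;> simp [a1.symm, a2.symm, a3.symm]
      · rw [asg_two, rank_two]; cases τ (cl i 0) <;> simp [a1.symm, a2.symm, a3.symm]
      · rw [asg_mid, rank_mid_inr]; simp
      · rw [asg_low, rank_low_inr]
        cases τ (cl i t) <;> simp [(pIt_ne t).symm]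
    · rintro ⟨i, k⟩
      rcases person_cases k with rfl | rfl | rfl | ⟨t, rfl⟩ | ⟨t, rfl⟩
      · rw [asg_zero]; rcases hcase i with h | h | h <;> simp [h]
      · rw [asg_one]; rcases hcase i with h | h | h <;> simp [h]
      · rw [asg_two]; rcases hcase i with h | h | h <;> simp [h]
      · rw [asg_mid]; trivial
      · rw [asg_low]; trivial
    · rintro ⟨i, k⟩ b' hg hav hne hE
      have a1 := h01 i
      have a2 := h02 i
      have a3 := h12 i
      have htop : ∀ h : k.1 < 3, ∃ u, b' = Sum.inl u := fun h => edge_top cl i k h b' hE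
      unfold Edge at hE
      rcases person_cases k with rfl | rfl | rfl | ⟨t, rfl⟩ | ⟨t, rfl⟩
      · obtain ⟨u, rfl⟩ := htop (by decide)
        change τ u = false at hav
        rw [asg_zero] at hne ⊢
        rw [rank_zero] at hE
        rw [rank_zero, rank_zero]
        have hne : u ≠ _ := fun h => hne (congrArg Sum.inl h)
        have hlt : (1 : ℕ∞) < 2 := by norm_num
        rcases hcase i with h | h | h <;> simp only [h] at hne ⊢ <;> grind [ENat.natCast_lt_top]
      · obtain ⟨u, rfl⟩ := htop (by decide)
        change τ u = false at hav
        rw [asg_one] at hne ⊢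
        rw [rank_one] at hE
        rw [rank_one, rank_one]
        have hne : u ≠ _ := fun h => hne (congrArg Sum.inl h)
        have hlt : (1 : ℕ∞) < 2 := by norm_num
        rcases hcase i with h | h | h <;> simp only [h] at hne ⊢ <;> grind [ENat.natCast_lt_top]
      · obtain ⟨u, rfl⟩ := htop (by decide)
        change τ u = false at hav
        rw [asg_two] at hne ⊢
        rw [rank_two] at hE
        rw [rank_two, rank_two]
        have hne : u ≠ _ := fun h => hne (congrArg Sum.inl h)
        have hlt : (1 : ℕ∞) < 2 := by norm_num
        rcases hcase i with h | h | h <;> simp only [h] at hne ⊢ <;> grind [ENat.natCast_lt_top]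
      · rw [asg_mid] at *
        obtain ⟨s, hs, hτs⟩ := hg
        obtain rfl := pIt_inj _ _ hs
        rcases b' with u | ⟨j, s⟩
        · rw [rank_mid_inl] at *
          have : u ≠ cl i t := by rintro rfl; simp_all
          simp [this] at hE
        · rw [rank_mid_inr] at hE
          have : ¬ (j = i ∧ s = pIt t) := by rintro ⟨rfl, rfl⟩; exact hne rfl
          simp [this] at hE
      · rw [asg_low] at hg
        exfalso
        obtain ⟨s, hs, hτs⟩ := hg
        by_cases h : τ (cl i t) = true
        · simp only [h, if_true] at hs
          exact pIt_ne s hs.symm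
        · simp only [h] at hs
          obtain rfl := pIt_inj _ _ hs
          exact h hτs
    · rintro ⟨i, k⟩ b' hav hlt
      rcases b' with u | ⟨j, s⟩
      · trivial
      have hE : Edge (instRank cl) (i, k) (Sum.inr (j, s)) := ne_top_of_lt hlt
      have htop : ∀ h : k.1 < 3, False := fun h => by
        obtain ⟨u, hu⟩ := edge_top cl i k h _ hE
        cases hu
      rcases person_cases k with rfl | rfl | rfl | ⟨t, rfl⟩ | ⟨t, rfl⟩
      · exact (htop (by decide)).elim
      · exact (htop (by decide)).elim
      · exact (htop (by decide)).elim
      · rw [asg_mid, rank_mid_inr, rank_mid_inr] at hlt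
        exfalso
        split_ifs at hlt <;> simp_all
      · rw [asg_low, rank_low_inr, rank_low_inr] at hlt
        have hp := pIt_ne t
        by_cases h : τ (cl i t) = true
        · simp only [h, if_true, hp.symm, if_false] at hlt
          by_cases hj : j = i
          · by_cases hs : s = pIt t
            · exact ⟨t, hs, hj ▸ h⟩
            · exfalso
              split_ifs at hlt <;> simp_all
          · simp [hj] at hlt
        · exfalso
          simp only [h, if_true] at hlt
          split_ifs at hlt <;> simp_all
  · unfold instTotalCost
    rw [sum_usage_mul, Fintype.sum_prod_type]
    rw [Finset.sum_congr rfl (g := fun _ => 14)]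
    · simp [mul_comm]
    · intro i _
      rw [sum_people, asg_zero, asg_one, asg_two]
      simp only [asg_mid, asg_low, cost_inl, cost_p, Fin.sum_univ_three]
      rcases hcase i with h | h | h <;> simp [h, cost_p, cost_q]

lemma forward {m n : ℕ} (cl : Fin m → Fin 3 → Fin n)
    (copies : InstItems m n → ℕ) (hcost : instTotalCost copies = 14 * m)
    (N : Fin m × Fin 9 → InstItems m n)
    (hP : PopularCap (instRank cl) copies (fun a => some (N a))) :
    ExactlyOneTrue cl (fun j => decide (copies (Sum.inl j) = 0)) := by
  have hE : ∀ a, Edge (instRank cl) a (N a) := fun a => hP.1.1 a _ rfl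
  have havail : ∀ a u, N a = Sum.inl u → copies (Sum.inl u) ≠ 0 := by
    intro a u h h0
    have h1 := hP.1.2 (Sum.inl u)
    have : Nonempty {a // (fun a => some (N a)) a = some (Sum.inl u)} := ⟨⟨a, by simp [h]⟩⟩
    have h2 : 0 < usage (fun a => some (N a)) (Sum.inl u) := by
      unfold usage; exact Nat.card_pos
    omega
  have htop : ∀ i (k : Fin 9), k.1 < 3 → instCost (N (i, k)) = 3 := by
    intro i k hk
    obtain ⟨u, hu⟩ := edge_top cl i k hk _ (hE (i, k))
    rw [hu, cost_inl]
  have hmid : ∀ i t, N (i, midP t) = Sum.inl (cl i t) ∨ N (i, midP t) = Sum.inr (i, pIt t) := by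
    intro i t
    have h := hE (i, midP t)
    unfold Edge at h
    rcases hN : N (i, midP t) with u | ⟨j, s⟩
    · rw [hN, rank_mid_inl] at h
      left
      by_contra hh
      exact h (if_neg (fun e => hh (by rw [e])))
    · rw [hN, rank_mid_inr] at h
      right
      by_contra hh
      exact h (if_neg (fun e => hh (by rw [e.1, e.2])))
  have hlow : ∀ i t, N (i, lowP t) = Sum.inr (i, pIt t) ∨ N (i, lowP t) = Sum.inr (i, 3) := by
    intro i t
    have h := hE (i, lowP t)
    unfold Edge at h
    rcases hN : N (i, lowP t) with u | ⟨j, s⟩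
    · rw [hN, rank_low_inl] at h; exact (h rfl).elim
    · rw [hN, rank_low_inr] at h
      split_ifs at h with h1 h2 h3
      · left; rw [h1, h2]
      · right; rw [h1, h3]
      · exact (h rfl).elim
      · exact (h rfl).elim
  have hpair : ∀ i t, (if copies (Sum.inl (cl i t)) = 0 then 1 else 2) ≤
      instCost (N (i, midP t)) + instCost (N (i, lowP t)) := by
    intro i t
    rcases hmid i t with h | h
    · rw [h, cost_inl]; split_ifs <;> omega
    · rw [h, cost_p]
      rcases hlow i t with h' | h'
      · rw [h', cost_p]; split_ifs <;> omega
      · rw [h', cost_q]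
        split_ifs with h0
        · omega
        · exfalso
          refine no_chain (instRank cl) copies _ hP (a := (i, midP t)) (c := (i, lowP t))
            (u := Sum.inl (cl i t)) (p := Sum.inr (i, pIt t)) (q := Sum.inr (i, 3))
            ?_ (by simp) (by simp) (by simp [h]) (by simp [h']) (Nat.pos_of_ne_zero h0) ?_ ?_
          · intro hh
            have := congrArg (fun x => x.2.1) hh
            simp [midP, lowP] at this
          · rw [rank_mid_inl, rank_mid_inr]; simp
          · rw [rank_low_inr, rank_low_inr]; simp [(pIt_ne t).symm]
  have hav0 : ∀ i, copies (Sum.inl (cl i 0)) ≠ 0 ∨ copies (Sum.inl (cl i 1)) ≠ 0 := by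
    intro i
    have h := hE (i, 0)
    obtain ⟨u, hu⟩ := edge_top cl i 0 (by decide) _ h
    have hc := havail _ _ hu
    unfold Edge at h
    rw [hu, rank_zero] at h
    split_ifs at h with h1 h2
    · exact Or.inl (h1 ▸ hc)
    · exact Or.inr (h2 ▸ hc)
    · exact (h rfl).elim
  have hav1 : ∀ i, copies (Sum.inl (cl i 1)) ≠ 0 ∨ copies (Sum.inl (cl i 2)) ≠ 0 := by
    intro i
    have h := hE (i, 1)
    obtain ⟨u, hu⟩ := edge_top cl i 1 (by decide) _ h
    have hc := havail _ _ hu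
    unfold Edge at h
    rw [hu, rank_one] at h
    split_ifs at h with h1 h2
    · exact Or.inl (h1 ▸ hc)
    · exact Or.inr (h2 ▸ hc)
    · exact (h rfl).elim
  have hav2 : ∀ i, copies (Sum.inl (cl i 0)) ≠ 0 ∨ copies (Sum.inl (cl i 2)) ≠ 0 := by
    intro i
    have h := hE (i, 2)
    obtain ⟨u, hu⟩ := edge_top cl i 2 (by decide) _ h
    have hc := havail _ _ hu
    unfold Edge at h
    rw [hu, rank_two] at h
    split_ifs at h with h1 h2
    · exact Or.inl (h1 ▸ hc)
    · exact Or.inr (h2 ▸ hc)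
    · exact (h rfl).elim
  have hclause : ∀ i, 9 + ∑ t, (if copies (Sum.inl (cl i t)) = 0 then 1 else 2) ≤
      ∑ k, instCost (N (i, k)) := by
    intro i
    rw [sum_people, htop i 0 (by decide), htop i 1 (by decide), htop i 2 (by decide)]
    exact Nat.add_le_add_left (Finset.sum_le_sum fun t _ => hpair i t) _
  have hge : ∀ i, 14 ≤ ∑ k, instCost (N (i, k)) := by
    intro i
    refine le_trans ?_ (hclause i)
    have := hav0 i
    have := hav1 i
    have := hav2 i
    rw [Fin.sum_univ_three]
    split_ifs <;> omega
  have htot : ∑ i, ∑ k, instCost (N (i, k)) ≤ ∑ _i : Fin m, 14 := by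
    rw [← Fintype.sum_prod_type (f := fun a => instCost (N a)), ← sum_usage_mul]
    refine le_trans (Finset.sum_le_sum fun b _ => Nat.mul_le_mul_right _ (hP.1.2 b)) ?_
    have : instTotalCost copies ≤ ∑ _i : Fin m, 14 := by rw [hcost]; simp [mul_comm]
    exact this
  have heq : ∀ i, ∑ k, instCost (N (i, k)) = 14 := by
    have h := (Finset.sum_eq_sum_iff_of_le (s := Finset.univ) (fun i _ => hge i)).1
      (le_antisymm (Finset.sum_le_sum fun i _ => hge i) htot)
    exact fun i => (h i (Finset.mem_univ _)).symm
  intro i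
  have h1 := hclause i
  rw [heq i, Fin.sum_univ_three] at h1
  have a0 := hav0 i
  have a1 := hav1 i
  have a2 := hav2 i
  by_cases c0 : copies (Sum.inl (cl i 0)) = 0
  · refine ⟨0, by simp [c0], ?_⟩
    intro k hk
    fin_cases k <;> simp_all
  by_cases c1 : copies (Sum.inl (cl i 1)) = 0
  · refine ⟨1, by simp [c1], ?_⟩
    intro k hk
    fin_cases k <;> simp_all
  by_cases c2 : copies (Sum.inl (cl i 2)) = 0
  · refine ⟨2, by simp [c2], ?_⟩
    intro k hk
    fin_cases k <;> simp_all
  simp [c0, c1, c2] at h1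

/-- There is a multiset of items of total cost exactly `14m` whose instance admits a
popular matching matching all people iff the monotone 1-in-3 SAT instance admits an
assignment setting exactly one literal true in every clause. -/
theorem min_cost_popular_instance_iff {m n : ℕ}
    (cl : Fin m → Fin 3 → Fin n) (hdist : ∀ i, Function.Injective (cl i)) :
    (∃ copies : InstItems m n → ℕ, instTotalCost copies = 14 * m ∧
      ∃ M : Fin m × Fin 9 → Option (InstItems m n),
        PopularCap (instRank cl) copies M ∧ ∀ a, (M a).isSome) ↔
    (∃ τ : Fin n → Bool, ExactlyOneTrue cl τ) := by
  constructor
  · rintro ⟨copies, hcost, M, hP, hall⟩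
    choose N hN using fun a => Option.isSome_iff_exists.1 (hall a)
    obtain rfl : M = fun a => some (N a) := funext hN
    exact ⟨_, forward cl copies hcost N hP⟩
  · rintro ⟨τ, hτ⟩
    obtain ⟨h1, h2⟩ := backward cl hdist τ hτ
    exact ⟨_, h2, _, h1, fun a => rfl⟩
end

section
/- In the min-cost augmentation reduction, a minimum-cost augmented instance admitting a popular matching has cost at most m if and only if the monotone 1-in-3 SAT instance has a satisfying assignment with exactly one true literal per clause. -/
/-- People of the min-cost augmentation construction: `Sum.inl (i,k)` (k = 0..5) are the
6 people of the clause-`i` gadget, and `Sum.inr j` is the person `x_j` of variable `X_j`. -/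
abbrev AugPeople (m n : ℕ) := (Fin m × Fin 6) ⊕ Fin n

/-- Items: `Sum.inl (i,0) = p_i`, `Sum.inl (i,1) = q_i`, `Sum.inl (i,2) = r_i` are the
internal items of clause `i`, and `Sum.inr j = u_j` is the public item of variable `X_j`. -/
abbrev AugItems (m n : ℕ) := (Fin m × Fin 3) ⊕ Fin n

/-- Preference lists (Fig. 2): for clause `Cᵢ = (X_{j₁} ∨ X_{j₂} ∨ X_{j₃})`, people
`a₁..a₃` have lists `(p_i, u_{j_k}, q_i)` and people `a₄..a₆` have lists `(r_i, u_{j_k})`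
for `k = 1,2,3`; person `x_j` has the single-item list `(u_j)`. -/
def augRank {m n : ℕ} (cl : Fin m → Fin 3 → Fin n) :
    AugPeople m n → AugItems m n → ℕ∞ := fun a b =>
  match a with
  | Sum.inl ik =>
      let i := ik.1
      let k : ℕ := (ik.2 : ℕ)
      match b with
      | Sum.inl it =>
          if it.1 = i then
            (if k ≤ 2 ∧ (it.2 : ℕ) = 0 then 1
             else if k ≤ 2 ∧ (it.2 : ℕ) = 1 then 3
             else if 3 ≤ k ∧ (it.2 : ℕ) = 2 then 1
             else ⊤)
          else ⊤
      | Sum.inr u =>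
          if k = 0 ∨ k = 3 then (if u = cl i 0 then 2 else ⊤)
          else if k = 1 ∨ k = 4 then (if u = cl i 1 then 2 else ⊤)
          else if k = 2 ∨ k = 5 then (if u = cl i 2 then 2 else ⊤)
          else ⊤
  | Sum.inr j =>
      match b with
      | Sum.inl _ => ⊤
      | Sum.inr u => if u = j then 1 else ⊤

/-- Costs per extra copy: each internal item `p_i, q_i, r_i` costs 2, each public item
`u_j` costs 1. -/
def augCostFn {m n : ℕ} : AugItems m n → ℕ := fun b =>
  match b with
  | Sum.inl _ => 2
  | Sum.inr _ => 1

/-- Cost of an augmentation `extra` (number of extra copies of each item). -/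
def augCost {m n : ℕ} (extra : AugItems m n → ℕ) : ℕ :=
  ∑ b : AugItems m n, extra b * augCostFn b


section helpers
open Classical

theorem usage_eq_card {α β : Type*} [Fintype α] (M : α → Option β) (b : β)
    [DecidablePred (fun a => M a = some b)] :
    usage M b = (Finset.univ.filter (fun a => M a = some b)).card := by
  unfold usage
  rw [Nat.card_eq_fintype_card, Fintype.card_subtype]

theorem usage_unique {α β : Type*} [Fintype α] {M : α → Option β} {b : β}
    (h : usage M b ≤ 1) {a c : α} (ha : M a = some b) (hc : M c = some b) : a = c := by
  rw [usage_eq_card] at h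
  exact Finset.card_le_one.1 h a (by simp [ha]) c (by simp [hc])

theorem usage_le_insert {α β : Type*} [Fintype α] {M M' : α → Option β} {b : β} {a : α}
    (h : ∀ x, M' x = some b → x = a ∨ M x = some b) : usage M' b ≤ usage M b + 1 := by
  rw [usage_eq_card, usage_eq_card]
  refine le_trans (Finset.card_le_card (t := insert a (Finset.univ.filter (fun a => M a = some b))) ?_)
    (Finset.card_insert_le _ _)
  intro x hx
  simpa using h x (by simpa using hx)

theorem usage_le_swap {α β : Type*} [Fintype α] {M M' : α → Option β} {b : β} {a c : α}
    (hc : M c = some b)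
    (h : ∀ x, M' x = some b → x = a ∨ (M x = some b ∧ x ≠ c)) : usage M' b ≤ usage M b := by
  rw [usage_eq_card, usage_eq_card]
  have hm : c ∈ Finset.univ.filter (fun a => M a = some b) := by simp [hc]
  rw [← Finset.card_erase_add_one hm]
  refine le_trans (Finset.card_le_card
    (t := insert a ((Finset.univ.filter (fun a => M a = some b)).erase c)) ?_)
    (Finset.card_insert_le _ _)
  intro x hx
  have := h x (by simpa using hx)
  simp only [Finset.mem_insert, Finset.mem_erase, Finset.mem_filter, Finset.mem_univ, true_and]
  tauto

theorem usage_le_sub {α β : Type*} [Fintype α] {M M' : α → Option β} {b : β}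
    (h : ∀ x, M' x = some b → M x = some b) : usage M' b ≤ usage M b := by
  rw [usage_eq_card, usage_eq_card]
  refine Finset.card_le_card ?_
  intro x hx
  simpa using h x (by simpa using hx)

theorem not_prefers_of_eq {α β : Type*} {rank : α → β → ℕ∞} {M M' : α → Option β} {a : α}
    (h : M a = M' a) : ¬ Prefers rank M M' a := by
  rintro (⟨b, h1, h2⟩ | ⟨b, b', h1, h2, h3⟩)
  · rw [h, h2] at h1; cases h1
  · rw [h, h2] at h1; cases h1; exact lt_irrefl _ h3

theorem not_prefers_symm {α β : Type*} {rank : α → β → ℕ∞} {M M' : α → Option β} {a : α}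
    (h : Prefers rank M' M a) : ¬ Prefers rank M M' a := by
  rcases h with ⟨b, h1, h2⟩ | ⟨b, b', h1, h2, h3⟩ <;>
  rintro (⟨c, h4, h5⟩ | ⟨c, c', h4, h5, h6⟩) <;> simp_all
  exact lt_asymm h3 h6

theorem prefers_of_better {α β : Type*} {rank : α → β → ℕ∞} {M M' : α → Option β} {a : α} {y : β}
    (h : M' a = some y) (hb : ∀ b, M a = some b → rank a y < rank a b) :
    Prefers rank M' M a := by
  cases hM : M a with
  | none => exact Or.inl ⟨y, h, hM⟩
  | some b => exact Or.inr ⟨y, b, h, hM, hb b hM⟩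

theorem morePopular_one {α β : Type*} [Fintype α] {rank : α → β → ℕ∞} {M M' : α → Option β}
    {a : α} (h1 : Prefers rank M' M a) (h2 : ∀ x, ¬ Prefers rank M M' x) :
    MorePopular rank M' M := by
  unfold MorePopular
  have : IsEmpty {a // Prefers rank M M' a} := ⟨fun x => h2 _ x.2⟩
  have : Nonempty {a // Prefers rank M' M a} := ⟨⟨a, h1⟩⟩
  rw [Nat.card_of_isEmpty]
  exact Nat.card_pos

theorem morePopular_two {α β : Type*} [Fintype α] {rank : α → β → ℕ∞} {M M' : α → Option β}
    {a b c : α} (hab : a ≠ b) (h1 : Prefers rank M' M a) (h1' : Prefers rank M' M b)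
    (h2 : ∀ x, Prefers rank M M' x → x = c) :
    MorePopular rank M' M := by
  unfold MorePopular
  have e1 : Nat.card {a // Prefers rank M M' a} ≤ 1 := by
    rw [Finite.card_le_one_iff_subsingleton]
    exact ⟨fun x y => Subtype.ext ((h2 _ x.2).trans (h2 _ y.2).symm)⟩
  have e2 : 1 < Nat.card {a // Prefers rank M' M a} := by
    rw [Finite.one_lt_card_iff_nontrivial]
    exact ⟨⟨a, h1⟩, ⟨b, h1'⟩, fun h => hab (congrArg Subtype.val h)⟩
  omega

/-- If `a` prefers `y` to its partner in a popular matching then `y` is full and everybody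
matched to `y` has no strictly better item. -/
theorem popular_block {α β : Type*} [Fintype α] {rank : α → β → ℕ∞} {copies : β → ℕ}
    {M : α → Option β} (hM : PopularCap rank copies M) (hpos : ∀ b, 0 < copies b)
    {a : α} {y : β} (hy : Edge rank a y)
    (hb : ∀ b, M a = some b → rank a y < rank a b) :
    usage M y = copies y ∧ ∀ b z, M b = some y → ¬ rank b z < rank b y := by
  obtain ⟨⟨hE, hC⟩, hP⟩ := hM
  have hay : M a ≠ some y := fun h => lt_irrefl _ (hb y h)
  refine ⟨?_, ?_⟩
  · by_contra hne
    have hlt : usage M y < copies y := lt_of_le_of_ne (hC y) hne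
    set M' : α → Option β := fun x => if x = a then some y else M x with hM'
    have hpa : Prefers rank M' M a := prefers_of_better (y := y) (by simp [hM']) hb
    refine hP M' ⟨?_, ?_⟩ (morePopular_one hpa ?_)
    · intro x b hx
      by_cases hxa : x = a
      · subst hxa; simp [hM'] at hx; subst hx; exact hy
      · simp [hM', hxa] at hx; exact hE _ _ hx
    · intro b
      by_cases hby : b = y
      · subst hby
        refine le_trans (usage_le_insert (M := M) (a := a) ?_) hlt
        intro x hx
        by_cases hxa : x = a
        · exact Or.inl hxa
        · right; simpa [hM', hxa] using hx
      · refine le_trans (usage_le_sub (M := M) ?_) (hC b)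
        intro x hx
        by_cases hxa : x = a
        · simp [hM', hxa] at hx; exact absurd hx.symm hby
        · simpa [hM', hxa] using hx
    · intro x
      by_cases hxa : x = a
      · subst hxa; exact not_prefers_symm hpa
      · exact not_prefers_of_eq (by simp [hM', hxa])
  · intro b z hby hbz
    have hab : a ≠ b := by rintro rfl; exact hay hby
    have hzy : z ≠ y := by rintro rfl; exact lt_irrefl _ hbz
    have hbE : Edge rank b z := ne_top_of_lt hbz
    by_cases hlt : usage M z < copies z
    · set M' : α → Option β := fun x => if x = a then some y else if x = b then some z else M x
        with hM'
      have hpa : Prefers rank M' M a := prefers_of_better (y := y) (by simp [hM']) hb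
      have hpb : Prefers rank M' M b := prefers_of_better (y := z) (by simp [hM', hab.symm])
        (by intro b' hb'; rw [hby] at hb'; cases hb'; exact hbz)
      refine hP M' ⟨?_, ?_⟩ (morePopular_one hpa ?_)
      · intro x w hx
        by_cases hxa : x = a
        · subst hxa; simp [hM'] at hx; subst hx; exact hy
        by_cases hxb : x = b
        · subst hxb; simp [hM', hxa] at hx; subst hx; exact hbE
        · simp [hM', hxa, hxb] at hx; exact hE _ _ hx
      · intro w
        by_cases hwy : w = y
        · subst hwy
          refine le_trans (usage_le_swap (M := M) (a := a) hby ?_) (hC w)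
          intro x hx
          by_cases hxa : x = a
          · exact Or.inl hxa
          right
          by_cases hxb : x = b
          · simp [hM', hxb, hab.symm, hzy] at hx
          · exact ⟨by simpa [hM', hxa, hxb] using hx, hxb⟩
        by_cases hwz : w = z
        · subst hwz
          refine le_trans (usage_le_insert (M := M) (a := b) ?_) hlt
          intro x hx
          by_cases hxb : x = b
          · exact Or.inl hxb
          right
          by_cases hxa : x = a
          · simp [hM', hxa, hzy.symm] at hx
          · simpa [hM', hxa, hxb] using hx
        · refine le_trans (usage_le_sub (M := M) ?_) (hC w)
          intro x hx
          by_cases hxa : x = a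
          · simp [hM', hxa] at hx; exact absurd hx.symm hwy
          by_cases hxb : x = b
          · simp [hM', hxb, hab.symm] at hx; exact absurd hx.symm hwz
          · simpa [hM', hxa, hxb] using hx
      · intro x
        by_cases hxa : x = a
        · subst hxa; exact not_prefers_symm hpa
        by_cases hxb : x = b
        · subst hxb; exact not_prefers_symm hpb
        · exact not_prefers_of_eq (by simp [hM', hxa, hxb])
    · by_cases hex : ∃ c, M c = some z
      · obtain ⟨c, hc⟩ := hex
        have hcb : c ≠ b := by rintro rfl; rw [hby] at hc; cases hc; exact hzy rfl
        set M' : α → Option β := fun x => if x = a then some y else if x = b then some z else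
          if x = c then none else M x with hM'
        have hpa : Prefers rank M' M a := prefers_of_better (y := y) (by simp [hM']) hb
        have hpb : Prefers rank M' M b := prefers_of_better (y := z) (by simp [hM', hab.symm])
          (by intro b' hb'; rw [hby] at hb'; cases hb'; exact hbz)
        refine hP M' ⟨?_, ?_⟩ (morePopular_two (c := c) hab hpa hpb ?_)
        · intro x w hx
          by_cases hxa : x = a
          · subst hxa; simp [hM'] at hx; subst hx; exact hy
          by_cases hxb : x = b
          · subst hxb; simp [hM', hxa] at hx; subst hx; exact hbE
          · simp [hM', hxa, hxb] at hx; exact hE _ _ hx.2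
        · intro w
          by_cases hwy : w = y
          · subst hwy
            refine le_trans (usage_le_swap (M := M) (a := a) hby ?_) (hC w)
            intro x hx
            by_cases hxa : x = a
            · exact Or.inl hxa
            right
            by_cases hxb : x = b
            · simp [hM', hxb, hab.symm, hzy] at hx
            · simp [hM', hxa, hxb] at hx
              exact ⟨hx.2, hxb⟩
          by_cases hwz : w = z
          · subst hwz
            refine le_trans (usage_le_swap (M := M) (a := b) hc ?_) (hC w)
            intro x hx
            by_cases hxb : x = b
            · exact Or.inl hxb
            right
            by_cases hxa : x = a
            · simp [hM', hxa, hzy.symm] at hx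
            · simp [hM', hxa, hxb] at hx
              exact ⟨hx.2, hx.1⟩
          · refine le_trans (usage_le_sub (M := M) ?_) (hC w)
            intro x hx
            by_cases hxa : x = a
            · simp [hM', hxa] at hx; exact absurd hx.symm hwy
            by_cases hxb : x = b
            · simp [hM', hxb, hab.symm] at hx; exact absurd hx.symm hwz
            · simp [hM', hxa, hxb] at hx
              exact hx.2
        · intro x hx
          by_contra hxc
          by_cases hxa : x = a
          · subst hxa; exact not_prefers_symm hpa hx
          by_cases hxb : x = b
          · subst hxb; exact not_prefers_symm hpb hx
          · exact not_prefers_of_eq (by simp [hM', hxa, hxb, hxc]) hx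
      · apply hlt
        have : usage M z = 0 := by
          rw [usage_eq_card, Finset.card_eq_zero, Finset.filter_eq_empty_iff]
          exact fun x _ hx => hex ⟨x, hx⟩
        rw [this]; exact hpos z

/-- Sufficient condition for popularity: every improver takes a single-copy item from somebody
for whom it is the strict first choice. -/
theorem not_morePopular_of {α β : Type*} [Fintype α] {rank : α → β → ℕ∞} {copies : β → ℕ}
    {M M' : α → Option β} (hM' : IsCapMatching rank copies M')
    (h : ∀ a, Prefers rank M' M a → ∃ y c, M' a = some y ∧ copies y = 1 ∧ M c = some y ∧ a ≠ c ∧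
      ∀ z, z ≠ y → rank c y < rank c z) : ¬ MorePopular rank M' M := by
  unfold MorePopular
  rw [not_lt]
  choose y c h1 h2 h3 h4 h5 using h
  refine Nat.card_le_card_of_injective
    (fun a : {a // Prefers rank M' M a} => (⟨c a.1 a.2, ?_⟩ : {a // Prefers rank M M' a})) ?_
  · have ha := a.2
    refine prefers_of_better (h3 _ ha) ?_
    intro b hb
    apply h5 _ ha
    rintro rfl
    refine h4 _ ha (usage_unique (M := M') ?_ (h1 _ ha) hb)
    rw [← h2 _ ha]; exact hM'.2 _
  · intro a b hab
    have hc : c a.1 a.2 = c b.1 b.2 := congrArg Subtype.val hab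
    have hy : y a.1 a.2 = y b.1 b.2 := by
      have := h3 _ a.2
      rw [hc, h3 _ b.2] at this
      exact (Option.some.inj this).symm
    apply Subtype.ext
    refine usage_unique (M := M') (b := y a.1 a.2) ?_ (h1 _ a.2) (by rw [hy]; exact h1 _ b.2)
    rw [← h2 _ a.2]; exact hM'.2 _

/-- The literal index of a clause person. -/
def lit6 : Fin 6 → Fin 3 := ![0, 1, 2, 0, 1, 2]

theorem rank_pub {m n : ℕ} (cl : Fin m → Fin 3 → Fin n) (i : Fin m) (l : Fin 6) (u : Fin n) :
    augRank cl (Sum.inl (i, l)) (Sum.inr u) = if u = cl i (lit6 l) then 2 else ⊤ := by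
  fin_cases l <;> simp [augRank, lit6] <;> congr

theorem rank_var {m n : ℕ} (cl : Fin m → Fin 3 → Fin n) (j u : Fin n) :
    augRank cl (Sum.inr j) (Sum.inr u) = if u = j then 1 else ⊤ := rfl

theorem rank_var_int {m n : ℕ} (cl : Fin m → Fin 3 → Fin n) (j : Fin n) (it : Fin m × Fin 3) :
    augRank cl (Sum.inr j) (Sum.inl it) = ⊤ := rfl

theorem rank_int {m n : ℕ} (cl : Fin m → Fin 3 → Fin n) (i : Fin m) (l : Fin 6)
    (i' : Fin m) (t : Fin 3) :
    augRank cl (Sum.inl (i, l)) (Sum.inl (i', t)) =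
      if i' = i then
        (if (l : ℕ) ≤ 2 ∧ (t : ℕ) = 0 then 1
             else if (l : ℕ) ≤ 2 ∧ (t : ℕ) = 1 then 3
             else if 3 ≤ (l : ℕ) ∧ (t : ℕ) = 2 then 1
             else ⊤)
      else ⊤ := rfl

theorem rank_first {m n : ℕ} (cl : Fin m → Fin 3 → Fin n) (i : Fin m) (l : Fin 6) :
    ∃ t, augRank cl (Sum.inl (i, l)) (Sum.inl (i, t)) = 1 := by
  by_cases h : (l : ℕ) ≤ 2
  · exact ⟨0, by simp [rank_int, h]⟩
  · exact ⟨2, by simp [rank_int, h]; omega⟩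

def lo (k : Fin 3) : Fin 6 := Fin.castAdd 3 k
def hi (k : Fin 3) : Fin 6 := Fin.natAdd 3 k

theorem lit6_lo (k : Fin 3) : lit6 (lo k) = k := by fin_cases k <;> rfl
theorem lit6_hi (k : Fin 3) : lit6 (hi k) = k := by fin_cases k <;> rfl

theorem lo_edge {m n : ℕ} {cl : Fin m → Fin 3 → Fin n} {i : Fin m} {k : Fin 3} {b : AugItems m n}
    (h : Edge (augRank cl) (Sum.inl (i, lo k)) b) :
    b = Sum.inl (i, 0) ∨ b = Sum.inr (cl i k) ∨ b = Sum.inl (i, 1) := by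
  rcases b with ⟨i', t⟩ | u
  · have : ((lo k : Fin 6) : ℕ) ≤ 2 := by simp [lo]; omega
    by_cases hi : i' = i
    · subst hi
      fin_cases t <;> simp [Edge, rank_int, this] at h ⊢
      omega
    · simp [Edge, rank_int, hi] at h
  · simp [Edge, rank_pub, lit6_lo] at h
    simp [h]

theorem hi_edge {m n : ℕ} {cl : Fin m → Fin 3 → Fin n} {i : Fin m} {k : Fin 3} {b : AugItems m n}
    (h : Edge (augRank cl) (Sum.inl (i, hi k)) b) :
    b = Sum.inl (i, 2) ∨ b = Sum.inr (cl i k) := by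
  rcases b with ⟨i', t⟩ | u
  · have : ¬ ((hi k : Fin 6) : ℕ) ≤ 2 := by simp [hi]
    by_cases hi : i' = i
    · subst hi
      fin_cases t <;> simp [Edge, rank_int, this] at h ⊢
    · simp [Edge, rank_int, hi] at h
  · simp [Edge, rank_pub, lit6_hi] at h
    simp [h]

section forward
variable {m n : ℕ} {cl : Fin m → Fin 3 → Fin n} {extra : AugItems m n → ℕ}
  {M : AugPeople m n → Option (AugItems m n)}

/-- Only `x_j` has `u_j` as first choice. -/
theorem block_pub (hM : PopularCap (augRank cl) (fun b => 1 + extra b) M) {a : AugPeople m n}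
    {j : Fin n} (hy : Edge (augRank cl) a (Sum.inr j))
    (hb : ∀ b, M a = some b → augRank cl a (Sum.inr j) < augRank cl a b) :
    M (Sum.inr j) = some (Sum.inr j) ∧ extra (Sum.inr j) = 0 := by
  obtain ⟨h1, h2⟩ := popular_block hM (fun b => by omega) hy hb
  have key : ∀ b, M b = some (Sum.inr j) → b = Sum.inr j := by
    intro b hbj
    have hE := hM.1.1 _ _ hbj
    rcases b with ⟨i, l⟩ | j'
    · exfalso
      obtain ⟨t, ht⟩ := rank_first cl i l
      apply h2 _ (Sum.inl (i, t)) hbj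
      rw [ht]
      rw [Edge, rank_pub] at hE
      rw [rank_pub]
      split_ifs at hE ⊢
      · norm_num
      · simp at hE
    · rw [Edge, rank_var] at hE
      by_cases h : j = j'
      · rw [h]
      · simp [h] at hE
  have hle : usage M (Sum.inr j) ≤ 1 := by
    rw [usage_eq_card, Finset.card_le_one]
    intro a ha b hb
    rw [key a (by simpa using ha), key b (by simpa using hb)]
  refine ⟨?_, by omega⟩
  have hpos : 0 < usage M (Sum.inr j) := by omega
  rw [usage_eq_card, Finset.card_pos] at hpos
  obtain ⟨b, hb⟩ := hpos
  have hb : M b = some (Sum.inr j) := by simpa using hb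
  have := key b hb
  rwa [this] at hb

theorem var_matched (hM : PopularCap (augRank cl) (fun b => 1 + extra b) M) (j : Fin n) :
    M (Sum.inr j) = some (Sum.inr j) := by
  by_contra hne
  refine hne (block_pub hM (a := Sum.inr j) (by simp [Edge, rank_var]) ?_).1
  intro b hb
  rcases b with ⟨i, l⟩ | j'
  · simp [rank_var, rank_var_int]
  · have : j' ≠ j := by rintro rfl; exact hne hb
    simp [rank_var, this]

theorem lo_cases (hM : PopularCap (augRank cl) (fun b => 1 + extra b) M) (i : Fin m) (k : Fin 3) :
    M (Sum.inl (i, lo k)) = some (Sum.inl (i, 0)) ∨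
    M (Sum.inl (i, lo k)) = some (Sum.inr (cl i k)) ∨
    M (Sum.inl (i, lo k)) = some (Sum.inl (i, 1)) := by
  have hk : ((lo k : Fin 6) : ℕ) ≤ 2 := by simp [lo]; omega
  cases h : M (Sum.inl (i, lo k)) with
  | some b =>
    simpa using lo_edge (hM.1.1 _ _ h)
  | none =>
    exfalso
    obtain ⟨h1, h2⟩ := popular_block hM (fun b => by omega) (a := Sum.inl (i, lo k))
      (y := Sum.inl (i, 1)) (by simp [Edge, rank_int, hk]) (by simp [h])
    have hpos : 0 < usage M (Sum.inl (i, 1)) := by omega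
    rw [usage_eq_card, Finset.card_pos] at hpos
    obtain ⟨b, hb⟩ := hpos
    have hb : M b = some (Sum.inl (i, 1)) := by simpa using hb
    have hE := hM.1.1 _ _ hb
    rcases b with ⟨i', l⟩ | j'
    · by_cases hi : i = i'
      · subst hi
        by_cases hl : (l : ℕ) ≤ 2
        · apply h2 _ (Sum.inl (i, 0)) hb
          simp [rank_int, hl]
        · simp [Edge, rank_int, hl] at hE
      · simp [Edge, rank_int, hi] at hE
    · simp [Edge, rank_var_int] at hE

theorem lo_true (hM : PopularCap (augRank cl) (fun b => 1 + extra b) M) (i : Fin m) (k : Fin 3)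
    (ht : 1 ≤ extra (Sum.inr (cl i k))) :
    M (Sum.inl (i, lo k)) = some (Sum.inl (i, 0)) ∨
    M (Sum.inl (i, lo k)) = some (Sum.inr (cl i k)) := by
  have hk : ((lo k : Fin 6) : ℕ) ≤ 2 := by simp [lo]; omega
  rcases lo_cases hM i k with h | h | h
  · exact Or.inl h
  · exact Or.inr h
  · exfalso
    have := (block_pub hM (a := Sum.inl (i, lo k)) (j := cl i k)
      (by simp [Edge, rank_pub, lit6_lo]) (by
        rw [h]; rintro b ⟨⟩; simp [rank_pub, lit6_lo, rank_int, hk]; decide)).2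
    omega

theorem hi_true (hM : PopularCap (augRank cl) (fun b => 1 + extra b) M) (i : Fin m) (k : Fin 3)
    (ht : 1 ≤ extra (Sum.inr (cl i k))) :
    M (Sum.inl (i, hi k)) = some (Sum.inl (i, 2)) ∨
    M (Sum.inl (i, hi k)) = some (Sum.inr (cl i k)) := by
  cases h : M (Sum.inl (i, hi k)) with
  | some b =>
    simpa using hi_edge (hM.1.1 _ _ h)
  | none =>
    exfalso
    have := (block_pub hM (a := Sum.inl (i, hi k)) (j := cl i k)
      (by simp [Edge, rank_pub, lit6_hi]) (by simp [h])).2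
    omega

/-- A person of clause `i` matched to a public item. -/
def OnPub (M : AugPeople m n → Option (AugItems m n)) (il : Fin m × Fin 6) : Prop :=
  ∃ j, M (Sum.inl il) = some (Sum.inr j)

noncomputable def clauseCost (extra : AugItems m n → ℕ)
    (M : AugPeople m n → Option (AugItems m n)) (i : Fin m) : ℕ :=
  (∑ t : Fin 3, extra (Sum.inl (i, t)) * 2) +
    (Finset.univ.filter (fun l : Fin 6 => OnPub M (i, l))).card

theorem pub_extra (hM : PopularCap (augRank cl) (fun b => 1 + extra b) M) {il : Fin m × Fin 6}
    {j : Fin n} (h : M (Sum.inl il) = some (Sum.inr j)) : 1 ≤ extra (Sum.inr j) := by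
  by_contra hc
  have hu : usage M (Sum.inr j) ≤ 1 := by
    have := hM.1.2 (Sum.inr j)
    dsimp only at this
    omega
  have := usage_unique hu h (var_matched hM j)
  cases this

theorem lo_inj {k k' : Fin 3} (h : lo k = lo k') : k = k' := Fin.castAdd_injective 3 3 h
theorem hi_inj {k k' : Fin 3} (h : hi k = hi k') : k = k' := Fin.natAdd_injective 3 3 h
theorem lo_ne_hi (k k' : Fin 3) : lo k ≠ hi k' := by
  intro h
  have := congrArg Fin.val h
  simp [lo, hi] at this
  omega

theorem clause_main (hM : PopularCap (augRank cl) (fun b => 1 + extra b) M) (i : Fin m) :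
    1 ≤ clauseCost extra M i ∧
    (clauseCost extra M i ≤ 1 → ∃! k : Fin 3, 1 ≤ extra (Sum.inr (cl i k))) := by
  unfold clauseCost
  by_cases hz : ∀ t, extra (Sum.inl (i, t)) = 0
  swap
  · push Not at hz
    obtain ⟨t, ht⟩ := hz
    have := Finset.single_le_sum (f := fun t : Fin 3 => extra (Sum.inl (i, t)) * 2)
      (fun _ _ => Nat.zero_le _) (Finset.mem_univ t)
    constructor
    · omega
    · intro h; omega
  have huse : ∀ t {a c}, M a = some (Sum.inl (i, t)) → M c = some (Sum.inl (i, t)) → a = c := by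
    intro t a c ha hc
    refine usage_unique ?_ ha hc
    have := hM.1.2 (Sum.inl (i, t))
    simpa [hz t] using this
  have hloinj : ∀ t k k', M (Sum.inl (i, lo k)) = some (Sum.inl (i, t)) →
      M (Sum.inl (i, lo k')) = some (Sum.inl (i, t)) → k = k' := by
    intro t k k' h h'
    have := huse t h h'
    simp only [Sum.inl.injEq, Prod.mk.injEq, true_and] at this
    exact lo_inj this
  have hhiinj : ∀ t k k', M (Sum.inl (i, hi k)) = some (Sum.inl (i, t)) →
      M (Sum.inl (i, hi k')) = some (Sum.inl (i, t)) → k = k' := by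
    intro t k k' h h'
    have := huse t h h'
    simp only [Sum.inl.injEq, Prod.mk.injEq, true_and] at this
    exact hi_inj this
  have hex : ∃ k, M (Sum.inl (i, lo k)) = some (Sum.inr (cl i k)) := by
    by_contra hno
    push Not at hno
    have hc : ∀ k, M (Sum.inl (i, lo k)) = some (Sum.inl (i, 0)) ∨
        M (Sum.inl (i, lo k)) = some (Sum.inl (i, 1)) := by
      intro k
      rcases lo_cases hM i k with h | h | h
      · exact Or.inl h
      · exact absurd h (hno k)
      · exact Or.inr h
    have n01 : (0 : Fin 3) ≠ 1 := by decide
    have n02 : (0 : Fin 3) ≠ 2 := by decide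
    have n12 : (1 : Fin 3) ≠ 2 := by decide
    rcases hc 0 with h0 | h0 <;> rcases hc 1 with h1 | h1 <;> rcases hc 2 with h2 | h2 <;>
      first
      | exact n01 (hloinj _ _ _ h0 h1)
      | exact n02 (hloinj _ _ _ h0 h2)
      | exact n12 (hloinj _ _ _ h1 h2)
  obtain ⟨k₀, hk₀⟩ := hex
  refine ⟨?_, ?_⟩
  · have : 0 < (Finset.univ.filter (fun l : Fin 6 => OnPub M (i, l))).card := by
      rw [Finset.card_pos]
      exact ⟨lo k₀, by simpa using ⟨_, hk₀⟩⟩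
    omega
  · intro hle
    refine ⟨k₀, pub_extra hM hk₀, ?_⟩
    intro k hk
    by_contra hne
    have hk0 := pub_extra hM hk₀
    have hhi : ∃ k', M (Sum.inl (i, hi k')) = some (Sum.inr (cl i k')) := by
      rcases hi_true hM i k hk with h | h
      · rcases hi_true hM i k₀ hk0 with h' | h'
        · exact absurd (hhiinj _ _ _ h h') hne
        · exact ⟨_, h'⟩
      · exact ⟨_, h⟩
    obtain ⟨k', hk'⟩ := hhi
    have hcard : (Finset.univ.filter (fun l : Fin 6 => OnPub M (i, l))).card ≤ 1 := by omega
    rw [Finset.card_le_one] at hcard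
    exact lo_ne_hi _ _ (hcard (lo k₀) (by simpa using ⟨_, hk₀⟩) (hi k') (by simpa using ⟨_, hk'⟩))

theorem sum_clauseCost (hM : PopularCap (augRank cl) (fun b => 1 + extra b) M) :
    ∑ i, clauseCost extra M i ≤ augCost extra := by
  have hpub : ∀ j, (Finset.univ.filter
      (fun il : Fin m × Fin 6 => M (Sum.inl il) = some (Sum.inr j))).card ≤ extra (Sum.inr j) := by
    intro j
    have h := hM.1.2 (Sum.inr j)
    rw [usage_eq_card] at h
    have hsub : insert (Sum.inr j) ((Finset.univ.filter
      (fun il : Fin m × Fin 6 => M (Sum.inl il) = some (Sum.inr j))).map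
        ⟨Sum.inl, Sum.inl_injective⟩) ⊆
        Finset.univ.filter (fun a : AugPeople m n => M a = some (Sum.inr j)) := by
      intro x hx
      simp only [Finset.mem_insert, Finset.mem_map, Finset.mem_filter, Finset.mem_univ, true_and,
        Function.Embedding.coeFn_mk] at hx ⊢
      rcases hx with rfl | ⟨il, h, rfl⟩
      · exact var_matched hM j
      · exact h
    have := (Finset.card_le_card hsub).trans h
    rw [Finset.card_insert_of_notMem (by simp), Finset.card_map] at this
    dsimp only at this
    omega
  have hcount : ∑ i, (Finset.univ.filter (fun l : Fin 6 => OnPub M (i, l))).card ≤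
      ∑ j, extra (Sum.inr j) := by
    calc ∑ i, (Finset.univ.filter (fun l : Fin 6 => OnPub M (i, l))).card
        = ∑ il : Fin m × Fin 6, if OnPub M il then 1 else 0 := by
          rw [Fintype.sum_prod_type]
          exact Finset.sum_congr rfl (fun i _ => by rw [Finset.card_filter])
      _ ≤ ∑ il : Fin m × Fin 6, ∑ j : Fin n,
            if M (Sum.inl il) = some (Sum.inr j) then 1 else 0 := by
          refine Finset.sum_le_sum (fun il _ => ?_)
          split_ifs with h
          · obtain ⟨j, hj⟩ := h
            refine le_trans ?_ (Finset.single_le_sum (fun _ _ => Nat.zero_le _) (Finset.mem_univ j))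
            simp [hj]
          · exact Nat.zero_le _
      _ = ∑ j : Fin n, ∑ il : Fin m × Fin 6,
            if M (Sum.inl il) = some (Sum.inr j) then 1 else 0 := Finset.sum_comm
      _ ≤ _ := by
          refine Finset.sum_le_sum (fun j _ => ?_)
          rw [← Finset.card_filter]
          exact hpub j
  unfold clauseCost augCost
  rw [Finset.sum_add_distrib, Fintype.sum_sum_type, Fintype.sum_prod_type]
  simp only [augCostFn, mul_one]
  omega

theorem forward_dir (hcost : augCost extra ≤ m)
    (hM : PopularCap (augRank cl) (fun b => 1 + extra b) M) :
    ∃ τ : Fin n → Bool, ExactlyOneTrue cl τ := by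
  have hs := (sum_clauseCost hM).trans hcost
  refine ⟨fun j => decide (1 ≤ extra (Sum.inr j)), fun i => ?_⟩
  simp only [decide_eq_true_eq]
  refine (clause_main hM i).2 ?_
  by_contra hlt
  have : ∑ _i : Fin m, 1 < ∑ i, clauseCost extra M i :=
    Finset.sum_lt_sum (fun i _ => (clause_main hM i).1) ⟨i, Finset.mem_univ _, by omega⟩
  simp at this
  omega

end forward

section backward
variable {m n : ℕ} {cl : Fin m → Fin 3 → Fin n} {κ : Fin m → Fin 3}

/-- Extra copies from the choice `κ` of the true literal. -/
noncomputable def bExtra (cl : Fin m → Fin 3 → Fin n) (κ : Fin m → Fin 3) : AugItems m n → ℕ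
  | Sum.inl _ => 0
  | Sum.inr j => (Finset.univ.filter (fun i => cl i (κ i) = j)).card

/-- The matching built from the choice `κ` of the true literal. -/
noncomputable def bMatch (cl : Fin m → Fin 3 → Fin n) (κ : Fin m → Fin 3) :
    AugPeople m n → Option (AugItems m n)
  | Sum.inl il =>
      if il.2 = lo (κ il.1) then some (Sum.inr (cl il.1 (κ il.1)))
      else if il.2 = lo (κ il.1 + 1) then some (Sum.inl (il.1, 0))
      else if il.2 = lo (κ il.1 + 2) then some (Sum.inl (il.1, 1))
      else if il.2 = hi (κ il.1) then some (Sum.inl (il.1, 2))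
      else none
  | Sum.inr j => some (Sum.inr j)

theorem bCost : augCost (bExtra cl κ) = m := by
  unfold augCost
  rw [Fintype.sum_sum_type]
  simp only [bExtra, augCostFn, zero_mul, Finset.sum_const_zero, mul_one, zero_add]
  rw [← Finset.card_eq_sum_card_fiberwise (s := Finset.univ) (t := Finset.univ)
    (f := fun i => cl i (κ i)) (by intro x _; simp)]
  simp

theorem person_cases_s13 (k : Fin 3) (l : Fin 6) :
    l = lo k ∨ l = lo (k + 1) ∨ l = lo (k + 2) ∨ l = hi k ∨ l = hi (k + 1) ∨ l = hi (k + 2) := by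
  revert k l; unfold lo hi; decide

theorem b0 (i : Fin m) : bMatch cl κ (Sum.inl (i, lo (κ i))) = some (Sum.inr (cl i (κ i))) := by
  simp [bMatch]
theorem b1 (i : Fin m) : bMatch cl κ (Sum.inl (i, lo (κ i + 1))) = some (Sum.inl (i, 0)) := by
  have : ∀ k, lo (k + 1) ≠ lo k := by unfold lo; decide
  simp [bMatch, this]
theorem b2 (i : Fin m) : bMatch cl κ (Sum.inl (i, lo (κ i + 2))) = some (Sum.inl (i, 1)) := by
  have h1 : ∀ k, lo (k + 2) ≠ lo k := by unfold lo; decide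
  have h2 : ∀ k, lo (k + 2) ≠ lo (k + 1) := by unfold lo; decide
  simp [bMatch, h1, h2]
theorem b3 (i : Fin m) : bMatch cl κ (Sum.inl (i, hi (κ i))) = some (Sum.inl (i, 2)) := by
  simp [bMatch, (lo_ne_hi _ _).symm]
theorem b4 (i : Fin m) : bMatch cl κ (Sum.inl (i, hi (κ i + 1))) = none := by
  have : ∀ k, hi (k + 1) ≠ hi k := by unfold hi; decide
  simp [bMatch, (lo_ne_hi _ _).symm, this]
theorem b5 (i : Fin m) : bMatch cl κ (Sum.inl (i, hi (κ i + 2))) = none := by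
  have : ∀ k, hi (k + 2) ≠ hi k := by unfold hi; decide
  simp [bMatch, (lo_ne_hi _ _).symm, this]

theorem lo_le (k : Fin 3) : ((lo k : Fin 6) : ℕ) ≤ 2 := by simp [lo]; omega
theorem hi_ge (k : Fin 3) : 3 ≤ ((hi k : Fin 6) : ℕ) := by simp [hi]
theorem hi_nle (k : Fin 3) : ¬ ((hi k : Fin 6) : ℕ) ≤ 2 := by simp [hi]

theorem bCap : IsCapMatching (augRank cl) (fun b => 1 + bExtra cl κ b) (bMatch cl κ) := by
  refine ⟨?_, ?_⟩
  · rintro (⟨i, l⟩ | j) b hb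
    · rcases person_cases_s13 (κ i) l with rfl | rfl | rfl | rfl | rfl | rfl
      · rw [b0] at hb; cases hb; simp [Edge, rank_pub, lit6_lo]
      · rw [b1] at hb; cases hb; simp [Edge, rank_int, lo_le]
      · rw [b2] at hb; cases hb; simp [Edge, rank_int, lo_le]
      · rw [b3] at hb; cases hb; simp [Edge, rank_int, hi_nle, hi_ge]
      · rw [b4] at hb; cases hb
      · rw [b5] at hb; cases hb
    · simp only [bMatch, Option.some.injEq] at hb
      subst hb; simp [Edge, rank_var]
  · rintro (⟨i, t⟩ | j)
    · refine le_trans ?_ (Nat.le_add_right 1 _)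
      rw [usage_eq_card, Finset.card_le_one]
      have key : ∀ a, bMatch cl κ a = some (Sum.inl (i, t)) →
          a = Sum.inl (i, ![lo (κ i + 1), lo (κ i + 2), hi (κ i)] t) := by
        rintro (⟨i', l⟩ | j') ha
        · rcases person_cases_s13 (κ i') l with rfl | rfl | rfl | rfl | rfl | rfl
          · rw [b0] at ha; cases ha
          · rw [b1] at ha; cases ha; simp
          · rw [b2] at ha; cases ha; simp
          · rw [b3] at ha; cases ha; simp
          · rw [b4] at ha; cases ha
          · rw [b5] at ha; cases ha
        · simp [bMatch] at ha
      intro a ha b hb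
      rw [key a (by simpa using ha), key b (by simpa using hb)]
    · rw [usage_eq_card]
      have hsub : Finset.univ.filter (fun a => bMatch cl κ a = some (Sum.inr j)) ⊆
          insert (Sum.inr j) ((Finset.univ.filter (fun i => cl i (κ i) = j)).image
            (fun i => Sum.inl (i, lo (κ i)))) := by
        intro a ha
        have ha : bMatch cl κ a = some (Sum.inr j) := by simpa using ha
        rcases a with ⟨i', l⟩ | j'
        · rcases person_cases_s13 (κ i') l with rfl | rfl | rfl | rfl | rfl | rfl
          · rw [b0] at ha
            simp only [Option.some.injEq, Sum.inr.injEq] at ha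
            refine Finset.mem_insert_of_mem (Finset.mem_image.2 ⟨i', by simpa using ha, rfl⟩)
          · rw [b1] at ha; cases ha
          · rw [b2] at ha; cases ha
          · rw [b3] at ha; cases ha
          · rw [b4] at ha; cases ha
          · rw [b5] at ha; cases ha
        · simp only [bMatch, Option.some.injEq, Sum.inr.injEq] at ha
          subst ha; simp
      refine le_trans (Finset.card_le_card hsub) (le_trans (Finset.card_insert_le _ _) ?_)
      have := Finset.card_image_le (s := Finset.univ.filter (fun i => cl i (κ i) = j))
        (f := fun i => (Sum.inl (i, lo (κ i)) : AugPeople m n))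
      simp only [bExtra]
      omega

theorem bPopular {τ : Fin n → Bool} (hκ : ∀ i, τ (cl i (κ i)) = true)
    (hu : ∀ i k, τ (cl i k) = true → k = κ i) :
    PopularCap (augRank cl) (fun b => 1 + bExtra cl κ b) (bMatch cl κ) := by
  refine ⟨bCap, fun M' hM' => not_morePopular_of hM' ?_⟩
  intro a ha
  -- an improver gets `p_i`, `r_i`, or a public item of a false variable
  have hget : ∃ y, M' a = some y ∧ bMatch cl κ a ≠ some y ∧ ((∃ i, y = Sum.inl (i, 0)) ∨
      (∃ i, y = Sum.inl (i, 2)) ∨ ∃ j, y = Sum.inr j ∧ τ j = false) := by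
    obtain ⟨y, hy⟩ : ∃ y, M' a = some y := by
      rcases ha with ⟨b, h, _⟩ | ⟨b, _, h, _⟩ <;> exact ⟨b, h⟩
    have hne : bMatch cl κ a ≠ some y := fun h => not_prefers_of_eq (hy.trans h.symm) ha
    have hlt : ∀ b, bMatch cl κ a = some b → augRank cl a y < augRank cl a b := by
      intro b hb
      rcases ha with ⟨c, h, h'⟩ | ⟨c, c', h, h', h''⟩
      · rw [hb] at h'; cases h'
      · rw [hy] at h; cases h; rw [hb] at h'; cases h'; exact h''
    have hfalse : ∀ i k, k ≠ κ i → τ (cl i k) = false := by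
      intro i k hk
      by_contra h
      exact hk (hu i k (by simpa using h))
    have hp1 : ∀ k : Fin 3, k + 1 ≠ k := by decide
    have hp2 : ∀ k : Fin 3, k + 2 ≠ k := by decide
    refine ⟨y, hy, hne, ?_⟩
    have hE := hM'.1 _ _ hy
    rcases a with ⟨i, l⟩ | j
    · rcases person_cases_s13 (κ i) l with rfl | rfl | rfl | rfl | rfl | rfl
      · rw [b0] at hlt hne
        rcases lo_edge hE with rfl | rfl | rfl
        · exact Or.inl ⟨i, rfl⟩
        · exact absurd rfl hne
        · have := hlt _ rfl
          simp [rank_int, rank_pub, lo_le, lit6_lo] at this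
      · rcases lo_edge hE with rfl | rfl | rfl
        · exact Or.inl ⟨i, rfl⟩
        · exact Or.inr (Or.inr ⟨_, rfl, hfalse _ _ (hp1 _)⟩)
        · have := hlt _ (b1 i)
          simp [rank_int, lo_le] at this
      · rcases lo_edge hE with rfl | rfl | rfl
        · exact Or.inl ⟨i, rfl⟩
        · exact Or.inr (Or.inr ⟨_, rfl, hfalse _ _ (hp2 _)⟩)
        · exact absurd (b2 i) hne
      · rcases hi_edge hE with rfl | rfl
        · exact Or.inr (Or.inl ⟨i, rfl⟩)
        · have := hlt _ (b3 i)
          simp [rank_int, rank_pub, hi_nle, hi_ge, lit6_hi] at this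
      · rcases hi_edge hE with rfl | rfl
        · exact Or.inr (Or.inl ⟨i, rfl⟩)
        · exact Or.inr (Or.inr ⟨_, rfl, hfalse _ _ (hp1 _)⟩)
      · rcases hi_edge hE with rfl | rfl
        · exact Or.inr (Or.inl ⟨i, rfl⟩)
        · exact Or.inr (Or.inr ⟨_, rfl, hfalse _ _ (hp2 _)⟩)
    · exfalso
      rcases y with it | u
      · exact hE rfl
      · have h : u = j := by
          by_contra h
          exact hE (by simp [rank_var, h])
        subst h
        exact hne rfl
  obtain ⟨y, hy, hne, hcase⟩ := hget
  suffices h : ∃ c, (1 + bExtra cl κ y = 1) ∧ bMatch cl κ c = some y ∧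
      ∀ z, z ≠ y → augRank cl c y < augRank cl c z by
    obtain ⟨c, h1, h2, h3⟩ := h
    exact ⟨y, c, hy, h1, h2, by rintro rfl; exact hne h2, h3⟩
  rcases hcase with ⟨i, rfl⟩ | ⟨i, rfl⟩ | ⟨j, rfl, hj⟩
  · refine ⟨_, rfl, b1 i, ?_⟩
    rintro (⟨i', t⟩ | u) hz
    · by_cases hi : i' = i
      · subst hi
        fin_cases t <;> simp [rank_int, lo_le] at hz ⊢
        have := lo_le (κ i' + 1)
        split_ifs <;> first | omega | simp
      · simp [rank_int, lo_le, hi]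
    · rw [rank_pub, rank_int]; simp only [lo_le]; split_ifs <;> simp_all
  · refine ⟨_, rfl, b3 i, ?_⟩
    rintro (⟨i', t⟩ | u) hz
    · by_cases hi : i' = i
      · subst hi
        fin_cases t <;> simp [rank_int, hi_nle, hi_ge] at hz ⊢
      · simp [rank_int, hi_nle, hi_ge, hi]
    · rw [rank_pub]; simp [rank_int, hi_nle, hi_ge]; split_ifs <;> simp
  · refine ⟨Sum.inr j, ?_, rfl, ?_⟩
    · simp only [bExtra, Nat.add_eq_left, Finset.card_eq_zero, Finset.filter_eq_empty_iff]
      rintro i - rfl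
      rw [hκ i] at hj; cases hj
    · rintro (it | u) hz
      · simp [rank_var, rank_var_int]
      · have : u ≠ j := by rintro rfl; exact hz rfl
        simp [rank_var, this]

end backward

end helpers

/-- A minimum-cost augmentation admitting a popular matching has cost at most `m` iff
the monotone 1-in-3 SAT instance has an assignment with exactly one true literal per
clause. -/
theorem min_cost_augmentation_iff {m n : ℕ}
    (cl : Fin m → Fin 3 → Fin n) (hdist : ∀ i, Function.Injective (cl i)) :
    (∃ extra : AugItems m n → ℕ, augCost extra ≤ m ∧
      ∃ M : AugPeople m n → Option (AugItems m n),
        PopularCap (augRank cl) (fun b => 1 + extra b) M) ↔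
    (∃ τ : Fin n → Bool, ExactlyOneTrue cl τ) := by
  constructor
  · rintro ⟨extra, hcost, M, hM⟩
    exact forward_dir hcost hM
  · rintro ⟨τ, hτ⟩
    choose κ hκ hu using hτ
    exact ⟨bExtra cl κ, bCost.le, bMatch cl κ, bPopular hκ hu⟩
end

section
/- In the min-cost perfect augmentation reduction, the minimum-cost augmented instance admitting a perfect popular matching (a popular matching matching every person) has cost exactly 4m if and only if the monotone 1-in-3 SAT instance admits an assignment with exactly one true literal per clause; under such an assignment, setting copies(u_j) = 2c_j + 1 for each false variable X_j (where c_j is the number of clauses containing X_j) and 1 otherwise yields a perfect popular matching at cost 4m. -/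
/-- People of the min-cost perfect augmentation construction: `Sum.inl (i,k)` (k = 0..5)
are the 6 people of the clause-`i` gadget, `Sum.inr j` is the person `x_j`. -/
abbrev PAugPeople (m n : ℕ) := (Fin m × Fin 6) ⊕ Fin n

/-- Items: `Sum.inl (i,0) = p_i`, `Sum.inl (i,1) = q_i` internal to clause `i`;
`Sum.inr j = u_j` public. -/
abbrev PAugItems (m n : ℕ) := (Fin m × Fin 2) ⊕ Fin n

/-- Preference lists (Fig. 5): for clause `Cᵢ = (X_{j₁} ∨ X_{j₂} ∨ X_{j₃})`, people
`a₁..a₃` have lists `(p_i, u_{j_k})` and people `a₄..a₆` have lists `(u_{j_k}, q_i)` for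
`k = 1,2,3`; person `x_j` has the single-item list `(u_j)`. -/
def paugRank {m n : ℕ} (cl : Fin m → Fin 3 → Fin n) :
    PAugPeople m n → PAugItems m n → ℕ∞ := fun a b =>
  match a with
  | Sum.inl ik =>
      let i := ik.1
      let k : ℕ := (ik.2 : ℕ)
      match b with
      | Sum.inl it =>
          if it.1 = i then
            (if k ≤ 2 ∧ (it.2 : ℕ) = 0 then 1
             else if 3 ≤ k ∧ (it.2 : ℕ) = 1 then 2
             else ⊤)
          else ⊤
      | Sum.inr u =>
          if k = 0 ∧ u = cl i 0 then 2
          else if k = 1 ∧ u = cl i 1 then 2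
          else if k = 2 ∧ u = cl i 2 then 2
          else if k = 3 ∧ u = cl i 0 then 1
          else if k = 4 ∧ u = cl i 1 then 1
          else if k = 5 ∧ u = cl i 2 then 1
          else ⊤
  | Sum.inr j =>
      match b with
      | Sum.inl _ => ⊤
      | Sum.inr u => if u = j then 1 else ⊤

/-- Costs per extra copy: each internal item `p_i, q_i` costs `m`, each public item
`u_j` costs 1. -/
def paugCostFn {n : ℕ} (m : ℕ) : (Fin m × Fin 2) ⊕ Fin n → ℕ := fun b =>
  match b with
  | Sum.inl _ => m
  | Sum.inr _ => 1

/-- Cost of an augmentation `extra` (number of extra copies of each item). -/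
def paugCost {m n : ℕ} (extra : PAugItems m n → ℕ) : ℕ :=
  ∑ b : PAugItems m n, extra b * paugCostFn m b

/-- Number of clauses containing variable `X_j`. -/
def numClausesOf {m n : ℕ} [DecidableEq (Fin n)] (cl : Fin m → Fin 3 → Fin n) (j : Fin n) : ℕ :=
  (Finset.univ.filter (fun i => ∃ k, cl i k = j)).card

/-- The augmentation determined by an assignment `τ`: each false variable `X_j` gets
`2·c_j` extra copies of `u_j` (so `copies (u_j) = 2c_j + 1`), true variables and internal
items get none. -/
def extraOf {m n : ℕ} (cl : Fin m → Fin 3 → Fin n) (τ : Fin n → Bool) :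
    PAugItems m n → ℕ := fun b =>
  match b with
  | Sum.inl _ => 0
  | Sum.inr j => if τ j then 0 else 2 * numClausesOf cl j

/-- The set of costs of augmentations admitting a perfect popular matching. -/
def PerfCosts {m n : ℕ} (cl : Fin m → Fin 3 → Fin n) : Set ℕ :=
  {c | ∃ extra : PAugItems m n → ℕ, paugCost extra = c ∧
    ∃ M : PAugPeople m n → Option (PAugItems m n),
      PopularCap (paugRank cl) (fun b => 1 + extra b) M ∧ ∀ a, (M a).isSome}

def loP (k : Fin 3) : Fin 6 := ⟨k.1, by omega⟩
def hiP (k : Fin 3) : Fin 6 := ⟨k.1 + 3, by omega⟩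

theorem fin6_cases (q : Fin 6) : ∃ k, q = loP k ∨ q = hiP k := by
  revert q; decide

theorem lo_inj_s19 (k l : Fin 3) : loP k = loP l ↔ k = l := by revert k l; decide
theorem hi_inj_s19 (k l : Fin 3) : hiP k = hiP l ↔ k = l := by revert k l; decide
theorem lo_ne_hi_s19 (k l : Fin 3) : loP k ≠ hiP l := by revert k l; decide
theorem hi_ne_lo (k l : Fin 3) : hiP l ≠ loP k := by revert k l; decide

section
variable {m n : ℕ} (cl : Fin m → Fin 3 → Fin n)

theorem people_cases (a : PAugPeople m n) :
    (∃ i k, a = Sum.inl (i, loP k)) ∨ (∃ i k, a = Sum.inl (i, hiP k)) ∨ ∃ j, a = Sum.inr j := by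
  rcases a with ⟨i, q⟩ | j
  · obtain ⟨k, h | h⟩ := fin6_cases q
    · exact Or.inl ⟨i, k, by rw [h]⟩
    · exact Or.inr (Or.inl ⟨i, k, by rw [h]⟩)
  · exact Or.inr (Or.inr ⟨j, rfl⟩)

theorem rank_lo_inl (i i' : Fin m) (k : Fin 3) (t : Fin 2) :
    paugRank cl (Sum.inl (i, loP k)) (Sum.inl (i', t)) = if i' = i ∧ t = 0 then 1 else ⊤ := by
  fin_cases k <;> fin_cases t <;> simp [paugRank, loP]

theorem rank_lo_inr (i : Fin m) (k : Fin 3) (u : Fin n) :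
    paugRank cl (Sum.inl (i, loP k)) (Sum.inr u) = if u = cl i k then 2 else ⊤ := by
  fin_cases k <;> simp [paugRank, loP]

theorem rank_hi_inl (i i' : Fin m) (k : Fin 3) (t : Fin 2) :
    paugRank cl (Sum.inl (i, hiP k)) (Sum.inl (i', t)) = if i' = i ∧ t = 1 then 2 else ⊤ := by
  fin_cases k <;> fin_cases t <;> simp [paugRank, hiP]

theorem rank_hi_inr (i : Fin m) (k : Fin 3) (u : Fin n) :
    paugRank cl (Sum.inl (i, hiP k)) (Sum.inr u) = if u = cl i k then 1 else ⊤ := by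
  fin_cases k <;> simp [paugRank, hiP]

theorem rank_x (j : Fin n) (b : PAugItems m n) :
    paugRank cl (Sum.inr j) b = if b = Sum.inr j then 1 else ⊤ := by
  rcases b with b | b <;> simp [paugRank]

theorem edge_lo (i : Fin m) (k : Fin 3) (b : PAugItems m n) :
    Edge (paugRank cl) (Sum.inl (i, loP k)) b ↔ b = Sum.inl (i, 0) ∨ b = Sum.inr (cl i k) := by
  rcases b with ⟨i', t⟩ | u
  · simp [Edge, rank_lo_inl]
  · simp [Edge, rank_lo_inr]

theorem edge_hi (i : Fin m) (k : Fin 3) (b : PAugItems m n) :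
    Edge (paugRank cl) (Sum.inl (i, hiP k)) b ↔ b = Sum.inl (i, 1) ∨ b = Sum.inr (cl i k) := by
  rcases b with ⟨i', t⟩ | u
  · simp [Edge, rank_hi_inl]
  · simp [Edge, rank_hi_inr]

theorem edge_x (j : Fin n) (b : PAugItems m n) :
    Edge (paugRank cl) (Sum.inr j) b ↔ b = Sum.inr j := by
  simp [Edge, rank_x]

theorem usage_eq (M : PAugPeople m n → Option (PAugItems m n)) (b) :
    usage M b = (Finset.univ.filter (fun a => M a = some b)).card := by
  rw [usage, Nat.card_eq_fintype_card, Fintype.card_subtype]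

theorem sum_usage (M : PAugPeople m n → Option (PAugItems m n)) (h : ∀ a, (M a).isSome) :
    ∑ b, usage M b = 6 * m + n := by
  have h1 := Finset.card_eq_sum_card_fiberwise (f := fun a => (M a).get (h a))
    (s := Finset.univ) (t := Finset.univ) (by simp)
  simp only [Finset.card_univ, Fintype.card_sum, Fintype.card_prod, Fintype.card_fin] at h1
  rw [mul_comm 6 m, h1]
  refine Finset.sum_congr rfl fun b _ => ?_
  rw [usage_eq]
  congr 1
  ext a
  simp only [Finset.mem_filter, Finset.mem_univ, true_and]
  constructor
  · intro h2; simp [h2]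
  · intro h2; rw [← h2]; simp

theorem cost_split (extra : PAugItems m n → ℕ) :
    paugCost extra = (∑ b, extra (Sum.inl b)) * m + ∑ j, extra (Sum.inr j) := by
  simp [paugCost, paugCostFn, Fintype.sum_sum_type, Finset.sum_mul]

theorem supply_split (extra : PAugItems m n → ℕ) :
    ∑ b, (1 + extra b) = 2 * m + n + ((∑ b, extra (Sum.inl b)) + ∑ j, extra (Sum.inr j)) := by
  rw [Finset.sum_add_distrib, Fintype.sum_sum_type extra]
  simp [mul_comm]

theorem extra_ge {extra : PAugItems m n → ℕ} {M : PAugPeople m n → Option (PAugItems m n)}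
    (hM : IsCapMatching (paugRank cl) (fun b => 1 + extra b) M) (h : ∀ a, (M a).isSome) :
    4 * m ≤ (∑ b, extra (Sum.inl b)) + ∑ j, extra (Sum.inr j) := by
  have h1 := sum_usage M h
  have h2 : ∑ b, usage M b ≤ ∑ b, (1 + extra b) := Finset.sum_le_sum fun b _ => hM.2 b
  rw [supply_split] at h2
  omega

theorem cost_ge {c : ℕ} (hc : c ∈ PerfCosts cl) : 4 * m ≤ c := by
  obtain ⟨extra, rfl, M, hM, hs⟩ := hc
  have h1 := extra_ge cl hM.1 hs
  rw [cost_split]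
  rcases Nat.eq_zero_or_pos m with rfl | hm
  · simp
  · have := Nat.le_mul_of_pos_right (∑ b : Fin m × Fin 2, extra (Sum.inl b)) hm
    omega

theorem tight {extra : PAugItems m n → ℕ} {M : PAugPeople m n → Option (PAugItems m n)}
    (hm : 2 ≤ m)
    (hM : IsCapMatching (paugRank cl) (fun b => 1 + extra b) M) (h : ∀ a, (M a).isSome)
    (hc : paugCost extra = 4 * m) :
    (∀ b, extra (Sum.inl b) = 0) ∧ ∀ b, usage M b = 1 + extra b := by
  have h1 := extra_ge cl hM h
  rw [cost_split] at hc
  have h0 : ∑ b, extra (Sum.inl b) = 0 := by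
    by_contra hne
    have hp : 0 < ∑ b, extra (Sum.inl b) := Nat.pos_of_ne_zero hne
    nlinarith
  have hsu := sum_usage M h
  have hsup := supply_split extra
  rw [h0] at hsup hc
  refine ⟨fun b => by simpa using (Finset.sum_eq_zero_iff.1 h0) b (Finset.mem_univ _), ?_⟩
  have := (Finset.sum_eq_sum_iff_of_le (s := Finset.univ) (f := usage M)
    (g := fun b => 1 + extra b) fun b _ => hM.2 b).1 (by omega)
  exact fun b => this b (Finset.mem_univ _)

open Classical in
theorem pref_card (P : PAugPeople m n → Prop) :
    Nat.card {a // P a} = (Finset.univ.filter P).card := by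
  rw [Nat.card_eq_fintype_card, Fintype.card_subtype]

theorem exchange {copies : PAugItems m n → ℕ} {M : PAugPeople m n → Option (PAugItems m n)}
    (hM : PopularCap (paugRank cl) copies M) (hs : ∀ a, (M a).isSome)
    (i i' : Fin m) (k k' l : Fin 3) (hl : M (Sum.inl (i, loP l)) = some (Sum.inl (i, 0)))
    (hk : M (Sum.inl (i, loP k)) = some (Sum.inr (cl i k))) (hj : cl i' k' = cl i k) :
    M (Sum.inl (i', hiP k')) = some (Sum.inr (cl i k)) := by
  by_contra hB
  have hBq : M (Sum.inl (i', hiP k')) = some (Sum.inl (i', 1)) := by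
    obtain ⟨b, hb⟩ := Option.isSome_iff_exists.1 (hs (Sum.inl (i', hiP k')))
    rcases (edge_hi cl _ _ _).1 (hM.1.1 _ _ hb) with rfl | rfl
    · exact hb
    · rw [hj] at hb; exact absurd hb hB
  obtain ⟨A, hA⟩ : ∃ A : PAugPeople m n, A = Sum.inl (i, loP k) := ⟨_, rfl⟩
  obtain ⟨L, hL⟩ : ∃ A : PAugPeople m n, A = Sum.inl (i, loP l) := ⟨_, rfl⟩
  obtain ⟨B, hBd⟩ : ∃ A : PAugPeople m n, A = Sum.inl (i', hiP k') := ⟨_, rfl⟩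
  rw [← hA] at hk
  rw [← hL] at hl
  rw [← hBd] at hBq
  have hAL : A ≠ L := by rintro rfl; rw [hl] at hk; simp at hk
  have hAB : A ≠ B := by rintro rfl; rw [hk] at hBq; simp at hBq
  have hLB : L ≠ B := by rintro rfl; rw [hl] at hBq; simp at hBq
  let M' : PAugPeople m n → Option (PAugItems m n) := fun a =>
    if a = L then none else if a = A then some (Sum.inl (i, 0)) else
    if a = B then some (Sum.inr (cl i k)) else M a
  have hM'L : M' L = none := by simp [M']
  have hM'A : M' A = some (Sum.inl (i, 0)) := by simp [M', hAL]
  have hM'B : M' B = some (Sum.inr (cl i k)) := by simp [M', hAB.symm, hLB.symm]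
  have hM'o : ∀ a, a ≠ L → a ≠ A → a ≠ B → M' a = M a := by
    intro a h1 h2 h3; simp [M', h1, h2, h3]
  clear_value M'
  refine hM.2 M' ⟨?_, ?_⟩ ?_
  · intro a b hab
    by_cases h1 : a = L
    · rw [h1, hM'L] at hab; simp at hab
    by_cases h2 : a = A
    · rw [h2, hM'A] at hab
      rw [h2, hA, edge_lo]
      left; simpa using hab.symm
    by_cases h3 : a = B
    · rw [h3, hM'B] at hab
      rw [h3, hBd, edge_hi, hj]
      right; simpa using hab.symm
    rw [hM'o a h1 h2 h3] at hab
    exact hM.1.1 _ _ hab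
  · intro b
    refine le_trans ?_ (hM.1.2 b)
    rw [usage_eq, usage_eq]
    refine Finset.card_le_card_of_injOn (fun a => if a = A then L else if a = B then A else a) ?_ ?_
    · intro a ha
      simp only [Finset.coe_filter, Finset.mem_univ, true_and, Set.mem_ofPred_eq] at ha ⊢
      grind
    · intro a ha a' ha' haa
      simp only [Finset.coe_filter, Finset.mem_univ, true_and, Set.mem_ofPred_eq] at ha ha' haa
      grind
  · unfold MorePopular
    classical
    rw [pref_card, pref_card]
    have c1 : Finset.univ.filter (Prefers (paugRank cl) M M') ⊆ {L} := by
      intro a ha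
      replace ha := (Finset.mem_filter.1 ha).2
      unfold Prefers at ha
      rw [Finset.mem_singleton]
      by_contra h1
      by_cases h2 : a = A
      · subst h2
        rw [hM'A, hk] at ha
        subst hA
        simp [rank_lo_inl, rank_lo_inr] at ha
      by_cases h3 : a = B
      · subst h3
        rw [hM'B, hBq] at ha
        subst hBd
        simp [rank_hi_inl, rank_hi_inr, hj] at ha
      rw [hM'o a h1 h2 h3] at ha
      grind
    have c2 : ({A, B} : Finset _) ⊆ Finset.univ.filter (Prefers (paugRank cl) M' M) := by
      intro a ha
      simp only [Finset.mem_filter, Finset.mem_univ, true_and]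
      simp only [Finset.mem_insert, Finset.mem_singleton] at ha
      right
      rcases ha with rfl | rfl
      · refine ⟨_, _, hM'A, hk, ?_⟩
        rw [hA]; simp [rank_lo_inl, rank_lo_inr]
      · refine ⟨_, _, hM'B, hBq, ?_⟩
        rw [hBd]; simp [rank_hi_inl, rank_hi_inr, hj]
    have := Finset.card_le_card c1
    have := Finset.card_le_card c2
    rw [Finset.card_pair hAB] at this
    rw [Finset.card_singleton] at *
    omega

theorem forward_s19 (hdist : ∀ i, Function.Injective (cl i)) (h : 4 * m ∈ PerfCosts cl) :
    ∃ τ : Fin n → Bool, ExactlyOneTrue cl τ := by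
  classical
  by_cases hm : m < 2
  · refine ⟨fun j => decide (∃ i, cl i 0 = j), fun i => ⟨0, by simp, ?_⟩⟩
    intro k hk
    simp only [decide_eq_true_eq] at hk
    obtain ⟨i', hi'⟩ := hk
    have : i' = i := by apply Fin.ext; omega
    subst this
    exact (hdist _ hi').symm
  obtain ⟨extra, hc, M, hM, hs⟩ := h
  obtain ⟨hz, hu⟩ := tight cl (by omega) hM.1 hs hc
  have edge : ∀ a, ∃ b, M a = some b ∧ Edge (paugRank cl) a b := fun a => by
    obtain ⟨b, hb⟩ := Option.isSome_iff_exists.1 (hs a)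
    exact ⟨b, hb, hM.1.1 _ _ hb⟩
  have hp : ∀ i, ∃ l, M (Sum.inl (i, loP l)) = some (Sum.inl (i, 0)) ∧
      ∀ k, k ≠ l → M (Sum.inl (i, loP k)) = some (Sum.inr (cl i k)) := by
    intro i
    have h1 := hu (Sum.inl (i, 0))
    rw [hz, usage_eq, add_zero, Finset.card_eq_one] at h1
    obtain ⟨a, ha⟩ := h1
    have ha' : ∀ b, M b = some (Sum.inl (i, 0)) ↔ b = a := fun b => by
      have := congrArg (b ∈ ·) ha
      simpa using this
    have haa := (ha' a).2 rfl
    have he := hM.1.1 _ _ haa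
    rcases people_cases a with ⟨i', l, rfl⟩ | ⟨i', l, rfl⟩ | ⟨j, rfl⟩
    · rw [edge_lo] at he
      have : i = i' := by simpa using he
      subst this
      refine ⟨l, haa, fun k hk => ?_⟩
      obtain ⟨b, hb, hbe⟩ := edge (Sum.inl (i, loP k))
      rcases (edge_lo cl _ _ _).1 hbe with rfl | rfl
      · have := (ha' _).1 hb
        simp [lo_inj_s19] at this
        exact absurd this hk
      · exact hb
    · rw [edge_hi] at he; simp at he
    · rw [edge_x] at he; simp at he
  have hq : ∀ i, ∃ l, M (Sum.inl (i, hiP l)) = some (Sum.inl (i, 1)) := by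
    intro i
    have h1 := hu (Sum.inl (i, 1))
    rw [hz, usage_eq, add_zero, Finset.card_eq_one] at h1
    obtain ⟨a, ha⟩ := h1
    have haa : M a = some (Sum.inl (i, 1)) := by
      have := congrArg (a ∈ ·) ha
      simpa using this
    have he := hM.1.1 _ _ haa
    rcases people_cases a with ⟨i', l, rfl⟩ | ⟨i', l, rfl⟩ | ⟨j, rfl⟩
    · rw [edge_lo] at he; simp at he
    · rw [edge_hi] at he
      have : i = i' := by simpa using he
      subst this
      exact ⟨l, haa⟩
    · rw [edge_x] at he; simp at he
  have key : ∀ i i' k k', M (Sum.inl (i, loP k)) = some (Sum.inr (cl i k)) → cl i' k' = cl i k →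
      M (Sum.inl (i', hiP k')) = some (Sum.inr (cl i k)) := by
    intro i i' k k' hk hj
    obtain ⟨l, hl, -⟩ := hp i
    exact exchange cl hM hs i i' k k' l hl hk hj
  refine ⟨fun j => decide (∀ i k, cl i k = j → M (Sum.inl (i, loP k)) ≠ some (Sum.inr (cl i k))),
    fun i => ?_⟩
  obtain ⟨l, hl, hl'⟩ := hp i
  obtain ⟨r, hr⟩ := hq i
  have hrl : r = l := by
    by_contra hne
    have := key i i r r (hl' r hne) rfl
    rw [hr] at this; simp at this
  subst hrl
  refine ⟨r, ?_, ?_⟩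
  · simp only [decide_eq_true_eq]
    intro i' k' hj hk
    have := key i' i k' r hk hj.symm
    rw [hr] at this; simp at this
  · intro k hk
    simp only [decide_eq_true_eq] at hk
    by_contra hne
    exact hk i k rfl (hl' k hne)

theorem numClauses_eq (hdist : ∀ i, Function.Injective (cl i)) (j : Fin n) :
    numClausesOf cl j = ∑ i, ∑ k, if cl i k = j then 1 else 0 := by
  rw [numClausesOf, Finset.card_filter]
  refine Finset.sum_congr rfl fun i _ => ?_
  split_ifs with h
  · obtain ⟨k, rfl⟩ := h
    simp [(hdist i).eq_iff]
  · push Not at h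
    simp [h]

theorem cost_extraOf (hdist : ∀ i, Function.Injective (cl i)) (τ : Fin n → Bool)
    (hτ : ExactlyOneTrue cl τ) : paugCost (extraOf cl τ) = 4 * m := by
  rw [cost_split]
  simp only [extraOf, Finset.sum_const_zero, zero_mul, zero_add]
  have h1 : ∀ j, (if τ j = true then 0 else 2 * numClausesOf cl j) =
      ∑ i, ∑ k, if cl i k = j then (if τ (cl i k) = true then 0 else 2) else 0 := by
    intro j
    rw [numClauses_eq cl hdist]
    split_ifs with h
    · symm
      refine Finset.sum_eq_zero fun i _ => Finset.sum_eq_zero fun k _ => ?_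
      split_ifs <;> simp_all
    · rw [Finset.mul_sum]
      refine Finset.sum_congr rfl fun i _ => ?_
      rw [Finset.mul_sum]
      refine Finset.sum_congr rfl fun k _ => ?_
      split_ifs <;> simp_all
  simp only [h1]
  rw [Finset.sum_comm]
  have h2 : ∀ i, ∑ j, ∑ k, (if cl i k = j then (if τ (cl i k) = true then 0 else 2) else 0) = 4 := by
    intro i
    rw [Finset.sum_comm]
    simp only [Finset.sum_ite_eq, Finset.mem_univ, if_true]
    obtain ⟨l, hl, hl'⟩ := hτ i
    have h3 : ∀ k, (if τ (cl i k) = true then 0 else 2) = if k = l then 0 else 2 := by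
      intro k
      by_cases hk : k = l
      · subst hk; simp [hl]
      · have : ¬ τ (cl i k) = true := fun h => hk (hl' k h)
        simp [hk, this]
    simp only [h3]
    clear h3 hl hl'
    revert l
    decide
  simp only [h2]
  simp [mul_comm]

def idx6 (q : Fin 6) : Fin 3 := ⟨q.1 % 3, Nat.mod_lt _ (by norm_num)⟩
theorem idx_lo (k : Fin 3) : idx6 (loP k) = k := by revert k; decide
theorem idx_hi (k : Fin 3) : idx6 (hiP k) = k := by revert k; decide

def theM (t : Fin m → Fin 3) : PAugPeople m n → Option (PAugItems m n)
  | Sum.inl (i, q) => if q = loP (t i) then some (Sum.inl (i, 0))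
      else if q = hiP (t i) then some (Sum.inl (i, 1)) else some (Sum.inr (cl i (idx6 q)))
  | Sum.inr j => some (Sum.inr j)

theorem theM_lo (t : Fin m → Fin 3) (i k) : theM cl t (Sum.inl (i, loP k)) =
    if k = t i then some (Sum.inl (i, 0)) else some (Sum.inr (cl i k)) := by
  simp [theM, lo_inj_s19, lo_ne_hi_s19, idx_lo]

theorem theM_hi (t : Fin m → Fin 3) (i k) : theM cl t (Sum.inl (i, hiP k)) =
    if k = t i then some (Sum.inl (i, 1)) else some (Sum.inr (cl i k)) := by
  simp [theM, hi_inj_s19, hi_ne_lo, idx_hi]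

theorem theM_x (t : Fin m → Fin 3) (j) : theM cl t (Sum.inr j) = some (Sum.inr j) := rfl

theorem theM_cap (hdist : ∀ i, Function.Injective (cl i)) (τ : Fin n → Bool) (t : Fin m → Fin 3)
    (ht : ∀ i k, τ (cl i k) = true ↔ k = t i) :
    IsCapMatching (paugRank cl) (fun b => 1 + extraOf cl τ b) (theM cl t) := by
  classical
  refine ⟨?_, ?_⟩
  · intro a b hab
    rcases people_cases a with ⟨i, k, rfl⟩ | ⟨i, k, rfl⟩ | ⟨j, rfl⟩
    · rw [theM_lo] at hab
      rw [edge_lo]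
      split_ifs at hab <;> simp_all
    · rw [theM_hi] at hab
      rw [edge_hi]
      split_ifs at hab <;> simp_all
    · rw [theM_x] at hab
      rw [edge_x]
      simp_all
  · intro b
    rw [usage_eq]
    rcases b with ⟨i, s⟩ | j
    · refine le_trans (b := 1) ?_ (Nat.le_add_right _ _)
      rw [Finset.card_le_one]
      have : ∀ a, theM cl t a = some (Sum.inl (i, s)) →
          a = Sum.inl (i, if s = 0 then loP (t i) else hiP (t i)) := by
        intro a ha
        rcases people_cases a with ⟨i', k, rfl⟩ | ⟨i', k, rfl⟩ | ⟨j, rfl⟩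
        · rw [theM_lo] at ha
          split_ifs at ha with h1
          · simp at ha; obtain ⟨rfl, rfl⟩ := ha; simp [h1]
          · simp at ha
        · rw [theM_hi] at ha
          split_ifs at ha with h1
          · simp at ha; obtain ⟨rfl, rfl⟩ := ha; simp [h1]
          · simp at ha
        · simp [theM_x] at ha
      intro a ha a' ha'
      simp only [Finset.mem_filter, Finset.mem_univ, true_and] at ha ha'
      rw [this a ha, this a' ha']
    · by_cases hj : τ j = true
      · refine le_trans (b := 1) ?_ (Nat.le_add_right _ _)
        have : ∀ a, theM cl t a = some (Sum.inr j) → a = Sum.inr j := by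
          intro a ha
          rcases people_cases a with ⟨i', k, rfl⟩ | ⟨i', k, rfl⟩ | ⟨j, rfl⟩
          · rw [theM_lo] at ha
            split_ifs at ha with h1
            · simp at ha
            · simp at ha; subst ha; exact absurd ((ht _ _).1 hj) h1
          · rw [theM_hi] at ha
            split_ifs at ha with h1
            · simp at ha
            · simp at ha; subst ha; exact absurd ((ht _ _).1 hj) h1
          · simpa [theM_x] using ha
        rw [Finset.card_le_one]
        intro a ha a' ha'
        simp only [Finset.mem_filter, Finset.mem_univ, true_and] at ha ha'
        rw [this a ha, this a' ha']
      · have hsub : Finset.univ.filter (fun a => theM cl t a = some (Sum.inr j)) ⊆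
            {Sum.inr j} ∪
            ((Finset.univ.filter (fun i => ∃ k, cl i k = j)).image
              (fun i => (Sum.inl (i, loP (Function.invFun (cl i) j)) : PAugPeople m n)) ∪
            (Finset.univ.filter (fun i => ∃ k, cl i k = j)).image
              (fun i => (Sum.inl (i, hiP (Function.invFun (cl i) j)) : PAugPeople m n))) := by
          intro a ha
          simp only [Finset.mem_filter, Finset.mem_univ, true_and] at ha
          simp only [Finset.mem_union, Finset.mem_image, Finset.mem_filter, Finset.mem_univ,
            true_and, Finset.mem_singleton]
          rcases people_cases a with ⟨i', k, rfl⟩ | ⟨i', k, rfl⟩ | ⟨j, rfl⟩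
          · rw [theM_lo] at ha
            split_ifs at ha with h1
            · simp at ha
            · simp at ha; subst ha
              exact Or.inr (Or.inl ⟨i', ⟨k, rfl⟩, by
                rw [Function.leftInverse_invFun (hdist i')]⟩)
          · rw [theM_hi] at ha
            split_ifs at ha with h1
            · simp at ha
            · simp at ha; subst ha
              exact Or.inr (Or.inr ⟨i', ⟨k, rfl⟩, by
                rw [Function.leftInverse_invFun (hdist i')]⟩)
          · left; simpa [theM_x] using ha
        refine (Finset.card_le_card hsub).trans ((Finset.card_union_le _ _).trans ?_)
        rw [Finset.card_singleton]
        refine Nat.add_le_add_left ((Finset.card_union_le _ _).trans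
          ((Nat.add_le_add Finset.card_image_le Finset.card_image_le).trans ?_)) _
        simp [extraOf, hj, numClausesOf, two_mul]

theorem usage_one {M : PAugPeople m n → Option (PAugItems m n)} {b} (h : usage M b ≤ 1)
    {a a'} (ha : M a = some b) (ha' : M a' = some b) : a = a' := by
  rw [usage_eq, Finset.card_le_one] at h
  exact h a (by simpa using ha) a' (by simpa using ha')

theorem theM_pop (hdist : ∀ i, Function.Injective (cl i)) (τ : Fin n → Bool) (t : Fin m → Fin 3)
    (ht : ∀ i k, τ (cl i k) = true ↔ k = t i) :
    PopularCap (paugRank cl) (fun b => 1 + extraOf cl τ b) (theM cl t) := by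
  classical
  refine ⟨theM_cap cl hdist τ t ht, ?_⟩
  intro M' hM'
  unfold MorePopular
  rw [not_lt, pref_card, pref_card]
  -- classification of people who improve
  have imp : ∀ a, Prefers (paugRank cl) M' (theM cl t) a →
      (∃ i k, a = Sum.inl (i, loP k) ∧ k ≠ t i ∧ M' a = some (Sum.inl (i, 0))) ∨
      (∃ i, a = Sum.inl (i, hiP (t i)) ∧ M' a = some (Sum.inr (cl i (t i)))) := by
    intro a ha
    rcases people_cases a with ⟨i, k, rfl⟩ | ⟨i, k, rfl⟩ | ⟨j, rfl⟩
    · left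
      rcases ha with ⟨b, -, h⟩ | ⟨b, b', hb, hb', hlt⟩
      · rw [theM_lo] at h; split_ifs at h
      · rw [theM_lo] at hb'
        have he := (edge_lo cl _ _ _).1 (hM'.1 _ _ hb)
        refine ⟨i, k, rfl, ?_, ?_⟩
        · rintro rfl
          simp at hb'; subst hb'
          rcases he with rfl | rfl <;> simp [rank_lo_inl, rank_lo_inr] at hlt
        · rcases he with rfl | rfl
          · exact hb
          · split_ifs at hb' <;> simp at hb' <;> subst hb' <;>
              simp [rank_lo_inl, rank_lo_inr] at hlt
    · right
      rcases ha with ⟨b, -, h⟩ | ⟨b, b', hb, hb', hlt⟩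
      · rw [theM_hi] at h; split_ifs at h
      · rw [theM_hi] at hb'
        have he := (edge_hi cl _ _ _).1 (hM'.1 _ _ hb)
        by_cases hk : k = t i
        · subst hk
          simp at hb'; subst hb'
          rcases he with rfl | rfl
          · simp at hlt
          · exact ⟨i, rfl, hb⟩
        · simp [hk] at hb'; subst hb'
          rcases he with rfl | rfl <;> simp [rank_hi_inl, rank_hi_inr] at hlt
    · exfalso
      rcases ha with ⟨b, -, h⟩ | ⟨b, b', hb, hb', hlt⟩
      · simp [theM_x] at h
      · simp [theM_x] at hb'; subst hb'
        have he := (edge_x cl _ _).1 (hM'.1 _ _ hb)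
        subst he
        simp at hlt
  have cap0 : ∀ i s, usage M' (Sum.inl (i, s)) ≤ 1 := fun i s => by
    simpa [extraOf] using hM'.2 (Sum.inl (i, s))
  have capT : ∀ i, usage M' (Sum.inr (cl i (t i))) ≤ 1 := fun i => by
    simpa [extraOf, (ht i (t i)).2 rfl] using hM'.2 (Sum.inr (cl i (t i)))
  let g : PAugPeople m n → PAugPeople m n := fun a => match a with
    | Sum.inl (i, q) => if q = hiP (t i) then Sum.inr (cl i (t i)) else Sum.inl (i, loP (t i))
    | Sum.inr j => Sum.inr j
  have g_hi : ∀ i, g (Sum.inl (i, hiP (t i))) = Sum.inr (cl i (t i)) := fun i => by simp [g]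
  have g_lo : ∀ i k, g (Sum.inl (i, loP k)) = Sum.inl (i, loP (t i)) := fun i k => by
    simp [g, lo_ne_hi_s19]
  clear_value g
  refine Finset.card_le_card_of_injOn g ?_ ?_
  · intro a ha
    simp only [Finset.coe_filter, Finset.mem_univ, true_and, Set.mem_ofPred_eq] at ha ⊢
    rcases imp a ha with ⟨i, k, rfl, hk, hM1⟩ | ⟨i, rfl, hM1⟩
    · rw [g_lo]
      cases hb : M' (Sum.inl (i, loP (t i))) with
      | none => left; exact ⟨_, by rw [theM_lo, if_pos rfl], hb⟩
      | some b =>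
        right
        refine ⟨_, b, by rw [theM_lo, if_pos rfl], hb, ?_⟩
        rcases (edge_lo cl _ _ _).1 (hM'.1 _ _ hb) with rfl | rfl
        · have := usage_one (cap0 i 0) hM1 hb
          simp [lo_inj_s19] at this
          exact absurd this hk
        · simp [rank_lo_inl, rank_lo_inr]
    · rw [g_hi]
      cases hb : M' (Sum.inr (cl i (t i))) with
      | none => left; exact ⟨_, theM_x _ _ _, hb⟩
      | some b =>
        exfalso
        have := (edge_x cl _ _).1 (hM'.1 _ _ hb)
        subst this
        have := usage_one (capT i) hM1 hb
        simp at this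
  · intro a ha a' ha' haa
    simp only [Finset.coe_filter, Finset.mem_univ, true_and, Set.mem_ofPred_eq] at ha ha'
    rcases imp a ha with ⟨i, k, rfl, hk, hM1⟩ | ⟨i, rfl, hM1⟩ <;>
    rcases imp a' ha' with ⟨i', k', rfl, hk', hM1'⟩ | ⟨i', rfl, hM1'⟩
    · rw [g_lo, g_lo] at haa
      simp at haa
      obtain ⟨rfl, -⟩ := haa
      exact usage_one (cap0 i 0) hM1 hM1'
    · rw [g_lo, g_hi] at haa; simp at haa
    · rw [g_lo, g_hi] at haa; simp at haa
    · rw [g_hi, g_hi] at haa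
      simp at haa
      rw [← haa] at hM1'
      exact usage_one (capT i) hM1 hM1'

theorem part2 (hdist : ∀ i, Function.Injective (cl i)) (τ : Fin n → Bool)
    (hτ : ExactlyOneTrue cl τ) : paugCost (extraOf cl τ) = 4 * m ∧
      ∃ M : PAugPeople m n → Option (PAugItems m n),
        PopularCap (paugRank cl) (fun b => 1 + extraOf cl τ b) M ∧ ∀ a, (M a).isSome := by
  refine ⟨cost_extraOf cl hdist τ hτ, ?_⟩
  choose t ht ht' using hτ
  refine ⟨theM cl t, theM_pop cl hdist τ t fun i k => ⟨ht' i k, ?_⟩, ?_⟩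
  · rintro rfl; exact ht i
  · intro a
    rcases people_cases a with ⟨i, k, rfl⟩ | ⟨i, k, rfl⟩ | ⟨j, rfl⟩
    · rw [theM_lo]; split_ifs <;> rfl
    · rw [theM_hi]; split_ifs <;> rfl
    · rfl
end

/-- The minimum cost of an augmented instance admitting a perfect popular matching is
exactly `4m` iff the monotone 1-in-3 SAT instance has an assignment with exactly one true
literal per clause; moreover, for any such assignment, giving each false variable `X_j`
copies `2c_j + 1` of `u_j` yields a perfect popular matching at cost `4m`. -/
theorem min_cost_perfect_augmentation {m n : ℕ}
    (cl : Fin m → Fin 3 → Fin n) (hdist : ∀ i, Function.Injective (cl i)) :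
    (IsLeast (PerfCosts cl) (4 * m) ↔ ∃ τ : Fin n → Bool, ExactlyOneTrue cl τ) ∧
    (∀ τ : Fin n → Bool, ExactlyOneTrue cl τ →
      paugCost (extraOf cl τ) = 4 * m ∧
      ∃ M : PAugPeople m n → Option (PAugItems m n),
        PopularCap (paugRank cl) (fun b => 1 + extraOf cl τ b) M ∧ ∀ a, (M a).isSome) := by
  refine ⟨⟨fun h => forward_s19 cl hdist h.1, ?_⟩, fun τ hτ => part2 cl hdist τ hτ⟩
  rintro ⟨τ, hτ⟩
  obtain ⟨h1, h2⟩ := part2 cl hdist τ hτ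
  exact ⟨⟨_, h1, h2⟩, fun c hc => cost_ge cl hc⟩
end
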